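/- arXiv:2112.01788 — 2 statements merged into one kernel-verified Lean document; each statement's English description precedes it below -/
import Mathlib

section
/- Let d ≥ 1, 0 < μ < 1, ν > 0 with μ + ν ≥ 1, C ≥ 1, r₁ > 0, r₂ ≥ 0, 0 < t₀ ≤ 1. Let (S(t))_{t≥0} be a strongly continuous contraction semigroup of bounded linear operators on L²(ℝ^d): S(0) = Id, S(t+s) = S(t)∘S(s) for all t,s ≥ 0, t ↦ S(t)g is continuous from [0,∞) to L²(ℝ^d) for every g, and ‖S(t)g‖_{L²(ℝ^d)} ≤ ‖g‖_{L²(ℝ^d)} for all t ≥ 0 and g ∈ L²(ℝ^d). Assume that for every 0 < t ≤ t₀ and every g ∈ L²(ℝ^d), S(t)g has a smooth representative satisfying ‖x^α ∂_x^β (S(t)g)‖_{L²(ℝ^d)} ≤ (C^{1+|α|+|β|}/t^{r₁(|α|+|β|)+r₂}) (α!)^ν (β!)^μ ‖g‖_{L²(ℝ^d)} for all multi-indices α, β ∈ ℕ^d. Let 0 ≤ δ < (1−μ)/ν and let ρ : ℝ^d → (0,∞) be a contraction mapping with m ≤ ρ(x) ≤ R⟨x⟩^δ for some m, R > 0 and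 all x, and let ω ⊆ ℝ^d be measurable and γ-thick with respect to ρ for some 0 < γ ≤ 1. Then there exists a constant K ≥ 1 such that for every g ∈ L²(ℝ^d) and every T > 0: ‖S(T)g‖²_{L²(ℝ^d)} ≤ K exp(K/T^{2r₁/(1−μ−δν)}) ∫₀^T ‖S(t)g‖²_{L²(ω)} dt. -/
open MeasureTheory Filter
open scoped ENNReal NNReal

noncomputable section

abbrev Esp (d : ℕ) := EuclideanSpace ℝ (Fin d)

/-- Japanese bracket `⟨x⟩ = (1+‖x‖²)^{1/2}`. -/
def jap {d : ℕ} (x : Esp d) : ℝ := Real.sqrt (1 + ‖x‖ ^ 2)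

/-- First-order partial derivative in direction `i`. -/
def pderivI {d : ℕ} (i : Fin d) (f : Esp d → ℂ) : Esp d → ℂ :=
  fun x => fderiv ℝ f x (EuclideanSpace.single i 1)

/-- Multi-index partial derivative `∂^β`. -/
def mderiv {d : ℕ} (β : Fin d → ℕ) (f : Esp d → ℂ) : Esp d → ℂ :=
  Fin.foldr d (fun i g => (pderivI i)^[β i] g) f

/-- `ρ` is a contraction mapping: `|ρ(x)-ρ(y)| ≤ L‖x-y‖` for some `0 ≤ L < 1`. -/
def IsContractionMap {d : ℕ} (ρ : Esp d → ℝ) : Prop :=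
  ∃ L : ℝ, 0 ≤ L ∧ L < 1 ∧ ∀ x y : Esp d, |ρ x - ρ y| ≤ L * ‖x - y‖

/-- `ω` is `γ`-thick with respect to the density `ρ`. -/
def IsThick {d : ℕ} (γ : ℝ) (ρ : Esp d → ℝ) (ω : Set (Esp d)) : Prop :=
  ∀ x : Esp d, ENNReal.ofReal γ * volume (Metric.ball x (ρ x)) ≤
    volume (ω ∩ Metric.ball x (ρ x))

/-- The Bang degree `n_{t,M,r}`. -/
def bangDeg (M : ℕ → ℝ) (t r : ℝ) : ℕ :=
  sSup {N : ℕ | (∑ n ∈ Finset.Icc 1 N, if -Real.log t < (n : ℝ) then M (n - 1) / M n else 0) < r}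

/-- `γ_M(p) = sup_{1≤j≤p} j (M_{j+1}M_{j-1}/M_j² - 1)`. -/
def gammaM (M : ℕ → ℝ) (p : ℕ) : ℝ :=
  ⨆ j : {j : ℕ // 1 ≤ j ∧ j ≤ p}, (j : ℝ) * (M (j + 1) * M (j - 1) / (M j) ^ 2 - 1)

/-- `Γ_M(p) = 4 e^{4+4γ_M(p)}`. -/
def GammaM (M : ℕ → ℝ) (p : ℕ) : ℝ := 4 * Real.exp (4 + 4 * gammaM M p)

/-- Quasi-analyticity: `∑_{p≥1} M_{p-1}/M_p = +∞`. -/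
def QuasiAnalytic (M : ℕ → ℝ) : Prop :=
  Tendsto (fun N => ∑ p ∈ Finset.Icc 1 N, M (p - 1) / M p) atTop atTop


lemma prod_erase_abs (i m : ℕ) :
    ∏ j ∈ (Finset.range (i + 1 + m)).erase i, |(i : ℝ) - j| = (i.factorial : ℝ) * m.factorial := by
  induction m with
  | zero =>
    have h1 : (Finset.range (i + 1 + 0)).erase i = Finset.range i := by
      ext a; simp; omega
    rw [h1, ← Finset.prod_range_reflect]
    rw [← Finset.prod_range_add_one_eq_factorial]
    push_cast
    simp only [Nat.factorial_zero, Nat.cast_one, mul_one]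
    refine Finset.prod_congr rfl fun j hj => ?_
    have hj' := Finset.mem_range.1 hj
    have : ((i - 1 - j : ℕ) : ℝ) = (i : ℝ) - 1 - j := by
      rw [Nat.cast_sub (by omega), Nat.cast_sub (by omega)]; simp
    rw [this, abs_of_nonneg]
    · ring
    · have : (0:ℝ) ≤ j := Nat.cast_nonneg j
      linarith
  | succ m ih =>
    have h1 : (Finset.range (i + 1 + (m + 1))).erase i
        = insert (i + 1 + m) ((Finset.range (i + 1 + m)).erase i) := by
      ext a; simp; omega
    rw [h1, Finset.prod_insert (by simp), ih, Nat.factorial_succ]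
    push_cast
    have : |(i : ℝ) - (i + 1 + m)| = m + 1 := by
      rw [abs_sub_comm, abs_of_nonneg]
      · ring
      · have : (0:ℝ) ≤ m := Nat.cast_nonneg m
        linarith
    rw [this]; ring

lemma lagrange_zero (n : ℕ) (x : ℕ → ℝ) (η B : ℝ) (hη : 0 < η)
    (hx : ∀ i ≤ n, x i ∈ Set.Icc (0:ℝ) 1)
    (hsep : ∀ i ≤ n, ∀ j ≤ n, η * |(i : ℝ) - j| ≤ |x i - x j|)
    (P : Polynomial ℂ) (hP : P.degree < (n + 1 : ℕ))
    (hB : ∀ i ≤ n, ‖P.eval ((x i : ℝ) : ℂ)‖ ≤ B) :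
    ‖P.eval 0‖ ≤ B * ((2 / η) ^ n / n.factorial) := by
  have hB0 : 0 ≤ B := le_trans (norm_nonneg _) (hB 0 (Nat.zero_le _))
  have hinj : Set.InjOn (fun i : ℕ => ((x i : ℝ) : ℂ)) (Finset.range (n+1)) := by
    intro i hi j hj hij
    have hi' : i ≤ n := by have := Finset.mem_range.1 (Finset.mem_coe.1 hi); omega
    have hj' : j ≤ n := by have := Finset.mem_range.1 (Finset.mem_coe.1 hj); omega
    have h := hsep i hi' j hj'
    have hxx : x i = x j := by simpa using hij
    rw [hxx, sub_self, abs_zero] at h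
    have : |(i : ℝ) - j| ≤ 0 := by
      by_contra hc
      push Not at hc
      nlinarith [mul_pos hη hc]
    have := abs_nonpos_iff.1 this
    exact_mod_cast sub_eq_zero.1 this
  have hdeg : P.degree < (Finset.range (n+1)).card := by simpa using hP
  have hE := congrArg (Polynomial.eval (0:ℂ)) (Lagrange.eq_interpolate hinj hdeg)
  rw [Lagrange.interpolate_apply, Polynomial.eval_finsetSum] at hE
  rw [hE]
  refine (norm_sum_le _ _).trans ?_
  have key : ∀ i ∈ Finset.range (n+1),
      ‖Polynomial.eval 0 (Polynomial.C (Polynomial.eval ((x i : ℝ) : ℂ) P) *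
        Lagrange.basis (Finset.range (n+1)) (fun i : ℕ => ((x i : ℝ) : ℂ)) i)‖
      ≤ B * ((1/η)^n / n.factorial * (n.choose i)) := by
    intro i hi
    have hi' : i ≤ n := by have := Finset.mem_range.1 hi; omega
    rw [Polynomial.eval_mul, Polynomial.eval_C, norm_mul]
    refine mul_le_mul (hB i hi') ?_ (norm_nonneg _) hB0
    unfold Lagrange.basis
    rw [Polynomial.eval_prod, norm_prod]
    have h1 : ∀ j ∈ (Finset.range (n+1)).erase i,
        ‖Polynomial.eval 0 (Lagrange.basisDivisor ((x i : ℝ) : ℂ) ((x j : ℝ) : ℂ))‖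
        ≤ (1/η) * |(i:ℝ) - j|⁻¹ := by
      intro j hj
      have hj' : j ≤ n := by
        have := Finset.mem_range.1 (Finset.mem_of_mem_erase hj); omega
      have hij : j ≠ i := Finset.ne_of_mem_erase hj
      have hpos : 0 < |(i:ℝ) - j| := by
        apply abs_pos.2; intro h; apply hij; exact_mod_cast (sub_eq_zero.1 h).symm
      unfold Lagrange.basisDivisor
      simp only [Polynomial.eval_mul, Polynomial.eval_C, Polynomial.eval_sub, Polynomial.eval_X,
        zero_sub, norm_mul, norm_inv, norm_neg]
      have e1 : ‖((x i : ℝ) : ℂ) - ((x j : ℝ) : ℂ)‖ = |x i - x j| := by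
        rw [← Complex.ofReal_sub, Complex.norm_real, Real.norm_eq_abs]
      have e2 : ‖((x j : ℝ) : ℂ)‖ ≤ 1 := by
        rw [Complex.norm_real, Real.norm_eq_abs, abs_of_nonneg (hx j hj').1]; exact (hx j hj').2
      rw [e1]
      have h2 := hsep i hi' j hj'
      have h3 : (|x i - x j|)⁻¹ ≤ (η * |(i:ℝ) - j|)⁻¹ :=
        inv_anti₀ (mul_pos hη hpos) h2
      calc |x i - x j|⁻¹ * ‖((x j : ℝ) : ℂ)‖ ≤ (η * |(i:ℝ) - j|)⁻¹ * 1 :=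
            mul_le_mul h3 e2 (norm_nonneg _) (by positivity)
        _ = _ := by rw [mul_inv]; ring
    refine (Finset.prod_le_prod (fun _ _ => norm_nonneg _) h1).trans ?_
    rw [Finset.prod_mul_distrib, Finset.prod_const, Finset.prod_inv_distrib,
      Finset.card_erase_of_mem hi, Finset.card_range, Nat.add_sub_cancel]
    obtain ⟨m, rfl⟩ := Nat.exists_eq_add_of_le hi'
    have e : i + m + 1 = i + 1 + m := by ring
    rw [e, prod_erase_abs, div_mul_eq_mul_div, mul_div_assoc]
    gcongr
    rw [Nat.cast_choose ℝ hi', Nat.add_sub_cancel_left]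
    have : ((i+m).factorial : ℝ) ≠ 0 := by positivity
    field_simp
    exact le_refl _
  refine (Finset.sum_le_sum key).trans ?_
  rw [← Finset.mul_sum, ← Finset.mul_sum]
  have : ∑ i ∈ Finset.range (n+1), (n.choose i : ℝ) = 2 ^ n := by
    exact_mod_cast Nat.sum_range_choose n
  rw [this]
  apply le_of_eq
  rw [div_pow, div_pow]; ring

lemma select_points (F : Set ℝ) (hF : MeasurableSet F) (hF1 : F ⊆ Set.Icc 0 1) (c : ℝ)
    (hc : 0 < c) (hvol : ENNReal.ofReal c ≤ volume F) (n : ℕ) :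
    ∃ x : ℕ → ℝ, (∀ i ≤ n, x i ∈ F) ∧
      ∀ i ≤ n, ∀ j ≤ n, c / (2 * (n+1)) * |(i : ℝ) - j| ≤ |x i - x j| := by
  set φ : ℝ → ℝ := fun s => (volume (F ∩ Set.Iic s)).toReal with hφ
  have hfin : ∀ A : Set ℝ, volume (F ∩ A) ≠ ∞ := fun A =>
    ne_top_of_le_ne_top (by simp : volume (Set.Icc (0:ℝ) 1) ≠ ∞)
      (measure_mono (Set.inter_subset_left.trans hF1))
  have hdiff : ∀ s t, s ≤ t → φ t = φ s + (volume (F ∩ Set.Ioc s t)).toReal := by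
    intro s t hst
    have : F ∩ Set.Iic t = (F ∩ Set.Iic s) ∪ (F ∩ Set.Ioc s t) := by
      rw [← Set.inter_union_distrib_left, Set.Iic_union_Ioc_eq_Iic hst]
    simp only [hφ]
    rw [this, measure_union _ (hF.inter measurableSet_Ioc), ENNReal.toReal_add (hfin _) (hfin _)]
    refine Set.disjoint_left.2 fun a ha hb => ?_
    exact absurd ha.2 (not_le.2 hb.2.1)
  have hIoc : ∀ s t, s ≤ t → (volume (F ∩ Set.Ioc s t)).toReal ≤ t - s := by
    intro s t hst
    have := measure_mono (μ := volume) (Set.inter_subset_right : F ∩ Set.Ioc s t ⊆ Set.Ioc s t)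
    rw [Real.volume_Ioc] at this
    exact ENNReal.toReal_le_of_le_ofReal (by linarith) this
  have hlip : ∀ s t, |φ s - φ t| ≤ |s - t| := by
    intro s t
    rcases le_total s t with h | h
    · have h1 := hdiff s t h
      have h2 := hIoc s t h
      have h3 : 0 ≤ (volume (F ∩ Set.Ioc s t)).toReal := ENNReal.toReal_nonneg
      rw [abs_sub_comm, abs_of_nonneg (by linarith), abs_sub_comm, abs_of_nonneg (by linarith)]
      linarith
    · have h1 := hdiff t s h
      have h2 := hIoc t s h
      have h3 : 0 ≤ (volume (F ∩ Set.Ioc t s)).toReal := ENNReal.toReal_nonneg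
      rw [abs_of_nonneg (by linarith), abs_of_nonneg (by linarith)]
      linarith
  have hcont : Continuous φ := by
    have : LipschitzWith 1 φ := LipschitzWith.of_dist_le_mul fun s t => by
      simpa [Real.dist_eq] using hlip s t
    exact this.continuous
  have h0 : φ 0 = 0 := by
    simp only [hφ]
    have : F ∩ Set.Iic 0 ⊆ {0} := fun a ha => le_antisymm ha.2 (hF1 ha.1).1
    rw [measure_mono_null this (by simp)]; simp
  have h1 : c ≤ φ 1 := by
    simp only [hφ]
    have : F ∩ Set.Iic 1 = F := Set.inter_eq_left.2 fun a ha => (hF1 ha).2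
    rw [this]
    refine (ENNReal.ofReal_le_iff_le_toReal ?_).1 hvol
    simpa using hfin Set.univ
  have hmono : Monotone φ := fun s t h => by
    have h1 := hdiff s t h
    have h3 : 0 ≤ (volume (F ∩ Set.Ioc s t)).toReal := ENNReal.toReal_nonneg
    linarith
  have hpick : ∀ a b : ℝ, 0 ≤ a → a < b → b ≤ c → ∃ s ∈ F, a ≤ φ s ∧ φ s ≤ b := by
    intro a b ha hab hb
    have iv := intermediate_value_Icc (zero_le_one (α := ℝ)) hcont.continuousOn
    obtain ⟨sa, hsa, hsa'⟩ := iv (⟨by rw [h0]; exact ha, by linarith⟩ : a ∈ Set.Icc (φ 0) (φ 1))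
    obtain ⟨sb, hsb, hsb'⟩ := iv (⟨by rw [h0]; linarith, by linarith⟩ : b ∈ Set.Icc (φ 0) (φ 1))
    have hlt : sa < sb := by
      by_contra hcon
      have := hmono (not_lt.1 hcon)
      linarith
    have hd := hdiff sa sb hlt.le
    have : (F ∩ Set.Ioc sa sb).Nonempty := by
      rw [Set.nonempty_iff_ne_empty]
      intro he
      rw [he] at hd
      simp at hd
      linarith
    obtain ⟨s, hs, hs2⟩ := this
    exact ⟨s, hs, by rw [← hsa']; exact hmono hs2.1.le, by rw [← hsb']; exact hmono hs2.2⟩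
  set q : ℝ := c / (2 * (n+1)) with hq
  have hn : (0:ℝ) < 2 * (n+1) := by positivity
  have hq0 : 0 < q := by positivity
  have hqc : q * (2 * (n+1)) = c := by rw [hq]; field_simp
  have hex : ∀ i : ℕ, ∃ s, i ≤ n → s ∈ F ∧ q * (2 * i) ≤ φ s ∧ φ s ≤ q * (2 * i + 1) := by
    intro i
    by_cases hi : i ≤ n
    · have hi' : (i:ℝ) ≤ n := by exact_mod_cast hi
      obtain ⟨s, hs, h2⟩ := hpick (q * (2*i)) (q * (2 * i + 1)) (by positivity)
        (by nlinarith) (by nlinarith)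
      exact ⟨s, fun _ => ⟨hs, h2⟩⟩
    · exact ⟨0, fun h => absurd h hi⟩
  choose x hx using hex
  refine ⟨x, fun i hi => (hx i hi).1, ?_⟩
  have main : ∀ i ≤ n, ∀ j ≤ n, i < j → q * |(i:ℝ) - j| ≤ |x i - x j| := by
    intro i hi j hj hij
    have hij' : (i:ℝ) + 1 ≤ j := by exact_mod_cast hij
    have a := (hx i hi).2.2
    have b := (hx j hj).2.1
    refine le_trans ?_ (hlip (x i) (x j))
    rw [abs_sub_comm, abs_of_nonneg (by linarith), abs_sub_comm]
    refine le_trans ?_ (le_abs_self _)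
    nlinarith
  intro i hi j hj
  rcases lt_trichotomy i j with h | h | h
  · exact main i hi j hj h
  · subst h; simp
  · have := main j hj i hi h
    rwa [abs_sub_comm, abs_sub_comm (x i)]

lemma taylor_bound (h : ℝ → ℂ) (hh : ContDiff ℝ (⊤ : ℕ∞) h) (n : ℕ) :
    ∃ P : Polynomial ℂ, P.degree < (n + 1 : ℕ) ∧ P.eval 0 = h 0 ∧
      ∀ θ ∈ Set.Icc (0:ℝ) 1, ‖h θ - P.eval ((θ:ℝ):ℂ)‖ ≤
        (1 / (n.factorial : ℝ)) * ∫ s in Set.Icc (0:ℝ) 1, ‖iteratedDeriv (n+1) h s‖ := by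
  set P : Polynomial ℂ := ∑ k ∈ Finset.range (n+1),
    Polynomial.C (((k.factorial : ℂ))⁻¹ * iteratedDeriv k h 0) * Polynomial.X ^ k with hPdef
  have hcontN : Continuous (iteratedDeriv (n+1) h) :=
    hh.continuous_iteratedDeriv _ (by exact_mod_cast le_top)
  have hP0 : P.eval 0 = h 0 := by
    rw [hPdef, Polynomial.eval_finsetSum, Finset.sum_eq_single 0]
    · simp
    · intro b _ hb; simp [hb]
    · simp
  refine ⟨P, ?_, hP0, ?_⟩
  · refine lt_of_le_of_lt (Polynomial.degree_sum_le _ _) ?_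
    rw [Finset.sup_lt_iff (by exact WithBot.bot_lt_coe _)]
    intro k hk
    refine lt_of_le_of_lt (Polynomial.degree_C_mul_X_pow_le _ _) ?_
    exact_mod_cast Finset.mem_range.1 hk
  · intro θ hθ
    have hnn : 0 ≤ (1 / (n.factorial : ℝ)) * ∫ s in Set.Icc (0:ℝ) 1, ‖iteratedDeriv (n+1) h s‖ :=
      mul_nonneg (by positivity) (integral_nonneg fun _ => norm_nonneg _)
    rcases eq_or_lt_of_le hθ.1 with h0 | h0
    · subst h0; simp [hP0]; simpa using hnn
    have hu : UniqueDiffOn ℝ (Set.uIcc 0 θ) := uniqueDiffOn_uIcc h0.ne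
    have hit : ∀ k : ℕ, ∀ s ∈ Set.uIcc 0 θ,
        iteratedDerivWithin k h (Set.uIcc 0 θ) s = iteratedDeriv k h s := fun k s hs =>
      iteratedDerivWithin_eq_iteratedDeriv hu
        ((hh.of_le (by exact_mod_cast le_top)).contDiffAt) hs
    have hT := taylor_integral_remainder (f := h) (x := θ) (x₀ := 0) (n := n)
      ((hh.of_le (by exact_mod_cast le_top)).contDiffOn)
    have hPe : P.eval ((θ:ℝ):ℂ) = taylorWithinEval h n (Set.uIcc 0 θ) 0 θ := by
      rw [taylor_within_apply, hPdef, Polynomial.eval_finsetSum]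
      refine Finset.sum_congr rfl fun k _ => ?_
      rw [hit k 0 Set.left_mem_uIcc]
      simp
      ring
    rw [hPe, hT]
    refine (intervalIntegral.norm_integral_le_integral_norm h0.le).trans ?_
    rw [intervalIntegral.integral_of_le h0.le, ← MeasureTheory.integral_const_mul]
    have integI : IntegrableOn (fun s => (1 / (n.factorial : ℝ)) * ‖iteratedDeriv (n+1) h s‖)
        (Set.Icc 0 1) :=
      (continuous_const.mul hcontN.norm).continuousOn.integrableOn_Icc
    calc _ ≤ ∫ s in Set.Ioc 0 θ, (1 / (n.factorial : ℝ)) * ‖iteratedDeriv (n+1) h s‖ := by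
          refine integral_mono_of_nonneg (Filter.Eventually.of_forall fun s => norm_nonneg _)
            (integI.mono_set (Set.Ioc_subset_Icc_self.trans (Set.Icc_subset_Icc_right hθ.2))) ?_
          filter_upwards [ae_restrict_mem measurableSet_Ioc] with s hs
          rw [hit (n+1) s (by rw [Set.uIcc_of_le h0.le]; exact ⟨hs.1.le, hs.2⟩), norm_smul]
          refine mul_le_mul_of_nonneg_right ?_ (norm_nonneg _)
          rw [Real.norm_eq_abs, abs_of_nonneg
            (div_nonneg (pow_nonneg (by linarith [hs.2]) _) (by positivity))]
          gcongr
          exact pow_le_one₀ (by linarith [hs.2]) (by linarith [hs.1, hθ.2])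
      _ ≤ _ := by
          refine setIntegral_mono_set integI ?_ ?_
          · exact Filter.Eventually.of_forall fun s => by positivity
          · exact (Set.Ioc_subset_Icc_self.trans (Set.Icc_subset_Icc_right hθ.2)).eventuallyLE
lemma one_dim (h : ℝ → ℂ) (hh : ContDiff ℝ (⊤ : ℕ∞) h) (n : ℕ) (F : Set ℝ)
    (hF : MeasurableSet F) (hF1 : F ⊆ Set.Icc 0 1) (c : ℝ)
    (hc : 0 < c) (hc1 : c ≤ 1) (hvol : ENNReal.ofReal c ≤ volume F) (B : ℝ)
    (hB : ∀ θ ∈ F, ‖h θ‖ ≤ B) :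
    ‖h 0‖ ≤ (12 / c) ^ (n+1) *
      (B + (1 / (n.factorial : ℝ)) * ∫ s in Set.Icc (0:ℝ) 1, ‖iteratedDeriv (n+1) h s‖) := by
  obtain ⟨P, hPd, hP0, hPh⟩ := taylor_bound h hh n
  obtain ⟨x, hxF, hsep⟩ := select_points F hF hF1 c hc hvol n
  set I := (1 / (n.factorial : ℝ)) * ∫ s in Set.Icc (0:ℝ) 1, ‖iteratedDeriv (n+1) h s‖
  have hBI : ∀ i ≤ n, ‖P.eval ((x i : ℝ) : ℂ)‖ ≤ B + I := by
    intro i hi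
    have h1 := hPh (x i) (hF1 (hxF i hi))
    have h2 := hB (x i) (hxF i hi)
    have h3 := norm_sub_norm_le (P.eval ((x i : ℝ) : ℂ)) (h (x i))
    rw [norm_sub_rev] at h3
    linarith
  have hBI0 : 0 ≤ B + I := (norm_nonneg _).trans (hBI 0 (Nat.zero_le _))
  have h1 := lagrange_zero n x (c / (2 * (n+1))) (B + I) (by positivity)
    (fun i hi => hF1 (hxF i hi)) hsep P hPd hBI
  rw [hP0] at h1
  refine h1.trans ?_
  rw [mul_comm]
  refine mul_le_mul_of_nonneg_right ?_ hBI0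
  have e1 : 2 / (c / (2 * ((n:ℝ)+1))) = 4 / c * (n+1) := by field_simp; ring
  rw [e1, mul_pow, mul_div_assoc]
  have e2 : ((n:ℝ)+1)^n / n.factorial ≤ Real.exp (n+1) :=
    Real.pow_div_factorial_le_exp _ (by positivity) n
  have e3 : Real.exp (n+1) ≤ 3 ^ (n+1) := by
    have := Real.exp_one_lt_three
    have e4 : Real.exp ((n:ℝ)+1) = Real.exp 1 ^ (n+1) := by
      rw [← Real.exp_nat_mul]; push_cast; ring_nf
    rw [e4]
    gcongr
  have e5 : (4 / c) ^ n ≤ (4/c)^(n+1) := by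
    apply pow_le_pow_right₀ _ (Nat.le_succ n)
    rw [le_div_iff₀ hc]; linarith
  calc (4/c)^n * (((n:ℝ)+1)^n / n.factorial) ≤ (4/c)^(n+1) * 3^(n+1) := by
        gcongr
        exact e2.trans e3
    _ = _ := by rw [← mul_pow]; congr 1; ring


lemma vol_preimage_line {d : ℕ} (x : Esp d) (θ : ℝ) (hθ : 0 < θ) (H : Set (Esp d)) :
    volume {y : Esp d | x + θ • (y - x) ∈ H} = ENNReal.ofReal ((θ⁻¹) ^ d) * volume H := by
  have : {y : Esp d | x + θ • (y - x) ∈ H} = AffineMap.homothety x θ⁻¹ '' H := by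
    ext y
    simp only [Set.mem_setOf_eq, Set.mem_image, AffineMap.homothety_apply, vsub_eq_sub,
      vadd_eq_add]
    constructor
    · intro h
      refine ⟨_, h, ?_⟩
      rw [add_sub_cancel_left, smul_smul, inv_mul_cancel₀ hθ.ne', one_smul, sub_add_cancel]
    · rintro ⟨z, hz, rfl⟩
      rw [add_sub_cancel_right, smul_smul, mul_inv_cancel₀ hθ.ne', one_smul, add_sub_cancel]
      exact hz
  rw [this, Measure.addHaar_image_homothety]
  simp [abs_of_nonneg hθ.le]

lemma vol_ball_scale {d : ℕ} (x : Esp d) (r θ : ℝ) (hθ : 0 < θ) :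
    volume (Metric.ball x (θ * r)) = ENNReal.ofReal (θ ^ d) * volume (Metric.ball x r) := by
  rw [Measure.addHaar_ball_mul_of_pos volume x hθ r, ← Measure.addHaar_ball_center volume x r]
  simp

lemma slice_vol {d : ℕ} (x : Esp d) (r : ℝ) (hr : 0 < r) (G : Set (Esp d))
    (hG : MeasurableSet G) (hGs : G ⊆ Metric.ball x r) (κ θ : ℝ)
    (hκ0 : 0 < κ) (hκ1 : κ ≤ 1) (hd : 1 ≤ d)
    (hvol : ENNReal.ofReal κ * volume (Metric.ball x r) ≤ volume G)
    (hθ : θ ∈ Set.Icc (1 - κ / (2 * d)) 1) :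
    ENNReal.ofReal (κ/2) * volume (Metric.ball x r) ≤
      volume ({y : Esp d | x + θ • (y - x) ∈ G} ∩ Metric.ball x r) := by
  have hd' : (1:ℝ) ≤ d := by exact_mod_cast hd
  have hη : κ / (2*d) ≤ 1/2 := by
    rw [div_le_iff₀ (by positivity)]; linarith
  have hθ0 : 0 < θ := by linarith [hθ.1]
  have hsub : {y : Esp d | x + θ • (y - x) ∈ G ∩ Metric.ball x (θ * r)} ⊆
      {y : Esp d | x + θ • (y - x) ∈ G} ∩ Metric.ball x r := by
    intro y hy
    refine ⟨hy.1, ?_⟩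
    have h2 := hy.2
    rw [Metric.mem_ball, dist_eq_norm, add_sub_cancel_left, norm_smul, Real.norm_eq_abs,
      abs_of_pos hθ0] at h2
    rw [Metric.mem_ball, dist_eq_norm]
    exact lt_of_mul_lt_mul_left h2 hθ0.le
  refine le_trans ?_ (measure_mono hsub)
  rw [vol_preimage_line x θ hθ0]
  have h1 : (1:ℝ≥0∞) ≤ ENNReal.ofReal ((θ⁻¹)^d) := by
    rw [ENNReal.one_le_ofReal]
    exact one_le_pow₀ ((one_le_inv₀ hθ0).2 hθ.2)
  refine le_trans ?_ (mul_le_mul_left h1 _)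
  rw [one_mul]
  have hBfin : volume (Metric.ball x r) ≠ ∞ := measure_ball_lt_top.ne
  have hle : θ * r ≤ r := by nlinarith [hθ.2]
  have hcov : volume G ≤ volume (G ∩ Metric.ball x (θ * r)) +
      (volume (Metric.ball x r) - ENNReal.ofReal (θ^d) * volume (Metric.ball x r)) := by
    rw [← vol_ball_scale x r θ hθ0, ← measure_sdiff (Metric.ball_subset_ball hle)
      measurableSet_ball.nullMeasurableSet measure_ball_lt_top.ne]
    refine le_trans (measure_mono ?_) (measure_union_le _ _)
    intro z hz
    by_cases h : z ∈ Metric.ball x (θ * r)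
    · exact Or.inl ⟨hz, h⟩
    · exact Or.inr ⟨hGs hz, h⟩
  have hbern : 1 - κ/2 ≤ θ^d := by
    have := one_add_mul_le_pow (a := θ - 1) (by linarith) d
    rw [add_sub_cancel] at this
    refine le_trans ?_ this
    have h3 := hθ.1
    have h4 : (d:ℝ) * (κ / (2*d)) = κ / 2 := by field_simp
    nlinarith
  have hH : volume (G ∩ Metric.ball x (θ * r)) ≠ ∞ :=
    ne_top_of_le_ne_top hBfin (measure_mono (Set.inter_subset_left.trans hGs))
  obtain ⟨b, hb⟩ : ∃ b : ℝ≥0, volume (Metric.ball x r) = b := ⟨_, (ENNReal.coe_toNNReal hBfin).symm⟩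
  obtain ⟨h, hh⟩ : ∃ b : ℝ≥0, volume (G ∩ Metric.ball x (θ * r)) = b :=
    ⟨_, (ENNReal.coe_toNNReal hH).symm⟩
  have hall := hvol.trans hcov
  rw [hb, hh] at *
  rw [← ENNReal.ofReal_coe_nnreal, ← ENNReal.ofReal_coe_nnreal] at *
  rw [← ENNReal.ofReal_mul (by positivity), ← ENNReal.ofReal_mul (by positivity),
    ← ENNReal.ofReal_sub _ (by positivity), ← ENNReal.ofReal_add (by positivity)
      (by nlinarith [b.2, pow_le_one₀ (n := d) hθ0.le hθ.2]),
      ENNReal.ofReal_le_ofReal_iff (by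
        have := h.2
        nlinarith [b.2, pow_le_one₀ (n := d) hθ0.le hθ.2])] at hall
  rw [← ENNReal.ofReal_mul (by positivity)]
  apply ENNReal.ofReal_le_ofReal
  have := b.2
  nlinarith

lemma good_dirs {d : ℕ} (x : Esp d) (r : ℝ) (hr : 0 < r) (G : Set (Esp d))
    (hG : MeasurableSet G) (hGs : G ⊆ Metric.ball x r) (κ : ℝ)
    (hκ0 : 0 < κ) (hκ1 : κ ≤ 1) (hd : 1 ≤ d)
    (hvol : ENNReal.ofReal κ * volume (Metric.ball x r) ≤ volume G) :
    ∃ Y : Set (Esp d), MeasurableSet Y ∧ Y ⊆ Metric.ball x r ∧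
      ENNReal.ofReal (κ^2 / (8 * d)) * volume (Metric.ball x r) ≤ volume Y ∧
      ∀ y ∈ Y, ENNReal.ofReal (κ^2/(8*d)) ≤
        volume {θ : ℝ | θ ∈ Set.Icc (0:ℝ) 1 ∧ x + θ • (y - x) ∈ G} := by
  have hd' : (1:ℝ) ≤ d := by exact_mod_cast hd
  set c := κ^2/(8*d) with hc
  have hc0 : 0 < c := by positivity
  set A : Set (Esp d × ℝ) := {p | p.2 ∈ Set.Icc (0:ℝ) 1 ∧ x + p.2 • (p.1 - x) ∈ G} with hA
  have hAm : MeasurableSet A := by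
    refine (measurable_snd measurableSet_Icc).inter ?_
    have : Measurable fun p : Esp d × ℝ => x + p.2 • (p.1 - x) := by
      apply Continuous.measurable; fun_prop
    exact this hG
  have hΦm := measurable_measure_prodMk_left (ν := (volume : Measure ℝ)) hAm
  set Φ : Esp d → ℝ≥0∞ := fun y => volume (Prod.mk y ⁻¹' A) with hΦ
  have hΦ1 : ∀ y, Φ y ≤ 1 := fun y => by
    have : Prod.mk y ⁻¹' A ⊆ Set.Icc (0:ℝ) 1 := fun θ h => h.1
    refine (measure_mono this).trans ?_
    simp
  set B := Metric.ball x r with hB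
  have hBm : MeasurableSet B := measurableSet_ball
  have hBfin : volume B ≠ ∞ := measure_ball_lt_top.ne
  refine ⟨{y | ENNReal.ofReal c ≤ Φ y} ∩ B, (measurableSet_le measurable_const hΦm).inter hBm,
    Set.inter_subset_right, ?_, fun y hy => hy.1⟩
  have hlow : ENNReal.ofReal (2 * c) * volume B ≤ ∫⁻ y in B, Φ y := by
    rw [← Measure.prod_apply hAm, Measure.prod_apply_symm hAm]
    calc ENNReal.ofReal (2 * c) * volume B
        = ∫⁻ θ in Set.Icc (1 - κ/(2*d)) 1, ENNReal.ofReal (κ/2) * volume B := by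
          rw [setLIntegral_const, Real.volume_Icc, mul_right_comm, ← ENNReal.ofReal_mul (by positivity)]
          congr 2
          rw [hc]; field_simp; ring
      _ ≤ ∫⁻ θ in Set.Icc (1 - κ/(2*d)) 1, (volume.restrict B) ((fun y => (y, θ)) ⁻¹' A) := by
          refine setLIntegral_mono' measurableSet_Icc fun θ hθ => ?_
          rw [Measure.restrict_apply' hBm]
          refine (slice_vol x r hr G hG hGs κ θ hκ0 hκ1 hd hvol hθ).trans (measure_mono ?_)
          refine Set.inter_subset_inter_left _ fun y hy => ⟨⟨?_, hθ.2⟩, hy⟩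
          have hη : κ / (2*d) ≤ 1/2 := by
            rw [div_le_iff₀ (by positivity)]; linarith
          linarith [hθ.1]
      _ ≤ _ := setLIntegral_le_lintegral _ _
  have hup : ∫⁻ y in B, Φ y ≤ volume ({y | ENNReal.ofReal c ≤ Φ y} ∩ B)
      + ENNReal.ofReal c * volume B := by
    calc ∫⁻ y in B, Φ y ≤ ∫⁻ y in B, (Set.indicator {y | ENNReal.ofReal c ≤ Φ y} 1 y
          + ENNReal.ofReal c) := by
          refine lintegral_mono fun y => ?_
          by_cases h : ENNReal.ofReal c ≤ Φ y
          · rw [Set.indicator_of_mem (show y ∈ {y | ENNReal.ofReal c ≤ Φ y} from h)]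
            exact (hΦ1 y).trans le_self_add
          · exact (not_le.1 h).le.trans le_add_self
      _ = _ := by
          rw [lintegral_add_right _ measurable_const, lintegral_indicator_one
            (measurableSet_le measurable_const hΦm), setLIntegral_const,
            Measure.restrict_apply' hBm]
  have := hlow.trans hup
  rw [two_mul, ENNReal.ofReal_add hc0.le hc0.le, add_mul] at this
  exact (ENNReal.add_le_add_iff_right (ENNReal.mul_ne_top ENNReal.ofReal_ne_top hBfin)).1 this


lemma enn_add_sq (a b : ℝ≥0∞) : (a + b)^2 ≤ 2 * (a^2 + b^2) := by
  induction a with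
  | top => simp
  | coe a =>
    induction b with
    | top => simp
    | coe b =>
      norm_cast
      have := add_sq_le (a := a) (b := b)
      simpa using this

lemma enn_jensen (H : ℝ → ℂ) (hH : Continuous H) :
    (∫⁻ s in Set.Icc (0:ℝ) 1, ‖H s‖ₑ)^2 ≤ ∫⁻ s in Set.Icc (0:ℝ) 1, ‖H s‖ₑ^2 := by
  have : IsProbabilityMeasure (volume.restrict (Set.Icc (0:ℝ) 1)) := ⟨by simp⟩
  have h1 := eLpNorm_le_eLpNorm_of_exponent_le (p := 1) (q := 2) (f := H)
    (μ := volume.restrict (Set.Icc (0:ℝ) 1)) (by norm_num) hH.aestronglyMeasurable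
  rw [eLpNorm_one_eq_lintegral_enorm] at h1
  have h2 := eLpNorm_nnreal_pow_eq_lintegral (p := 2) (f := H)
    (μ := volume.restrict (Set.Icc (0:ℝ) 1)) (by norm_num)
  simp at h2
  rw [← h2]
  gcongr

lemma markov_set {d : ℕ} (f : Esp d → ℂ) (hf : Continuous f) (x : Esp d) (r : ℝ) (hr : 0 < r)
    (ω : Set (Esp d)) (hω : MeasurableSet ω) (γ : ℝ) (hγ0 : 0 < γ)
    (hthick : ENNReal.ofReal γ * volume (Metric.ball x r) ≤ volume (ω ∩ Metric.ball x r))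
    (hI : ∫⁻ z in ω ∩ Metric.ball x r, ‖f z‖ₑ^2 ≠ ∞) :
    ∃ G : Set (Esp d), MeasurableSet G ∧ G ⊆ Metric.ball x r ∧
      ENNReal.ofReal (γ/2) * volume (Metric.ball x r) ≤ volume G ∧
      ∀ z ∈ G, ‖f z‖ₑ^2 ≤ ENNReal.ofReal (2/γ) * ((volume (Metric.ball x r))⁻¹ *
        ∫⁻ z in ω ∩ Metric.ball x r, ‖f z‖ₑ^2) := by
  set B := Metric.ball x r with hB
  have hBm : MeasurableSet B := measurableSet_ball
  have hBfin : volume B ≠ ∞ := measure_ball_lt_top.ne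
  have hB0 : volume B ≠ 0 := (Metric.measure_ball_pos volume x hr).ne'
  set I := ∫⁻ z in ω ∩ B, ‖f z‖ₑ^2 with hIdef
  set b0 := ENNReal.ofReal (2/γ) * ((volume B)⁻¹ * I) with hb0
  have hfm : Measurable fun z => ‖f z‖ₑ^2 := by
    have := hf.measurable; fun_prop
  have hωB : MeasurableSet (ω ∩ B) := hω.inter hBm
  have hGm : MeasurableSet {z | ‖f z‖ₑ^2 ≤ b0} := measurableSet_le hfm measurable_const
  have hrel : b0 * (ENNReal.ofReal (γ/2) * volume B) = I := by
    rw [hb0]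
    calc _ = (ENNReal.ofReal (2/γ) * ENNReal.ofReal (γ/2)) * ((volume B)⁻¹ * volume B) * I := by ring
      _ = I := by
        rw [← ENNReal.ofReal_mul (by positivity), ENNReal.inv_mul_cancel hB0 hBfin,
          show 2/γ * (γ/2) = 1 by field_simp]
        simp
  have hm : volume ({z | ‖f z‖ₑ^2 ≤ b0}ᶜ ∩ (ω ∩ B)) ≤ ENNReal.ofReal (γ/2) * volume B := by
    by_cases h0 : I = 0
    · have h1 := (lintegral_eq_zero_iff hfm).1 h0
      have hb : b0 = 0 := by rw [hb0, h0]; simp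
      have h2 : (volume.restrict (ω ∩ B)) {z | ‖f z‖ₑ^2 ≤ b0}ᶜ = 0 := by
        rw [← mem_ae_iff]
        filter_upwards [h1] with z hz
        exact hz.le.trans (by simp)
      rw [Measure.restrict_apply' hωB] at h2
      rw [h2]; exact bot_le
    · have h1 := mul_meas_ge_le_lintegral (μ := volume.restrict (ω ∩ B)) hfm b0
      have h2 : volume ({z | ‖f z‖ₑ^2 ≤ b0}ᶜ ∩ (ω ∩ B)) ≤
          (volume.restrict (ω ∩ B)) {z | b0 ≤ ‖f z‖ₑ^2} := by
        rw [Measure.restrict_apply' hωB]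
        refine measure_mono (Set.inter_subset_inter_left _ fun z hz => ?_)
        exact (not_le.1 (show ¬ ‖f z‖ₑ^2 ≤ b0 from hz)).le
      have h3 : b0 * volume ({z | ‖f z‖ₑ^2 ≤ b0}ᶜ ∩ (ω ∩ B)) ≤
          b0 * (ENNReal.ofReal (γ/2) * volume B) := by
        rw [hrel]
        exact le_trans (mul_le_mul_right h2 _) h1
      have hbne : b0 ≠ 0 := by
        intro h; rw [h, zero_mul] at hrel; exact h0 hrel.symm
      have hbtop : b0 ≠ ∞ := by
        rw [hb0]
        exact ENNReal.mul_ne_top ENNReal.ofReal_ne_top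
          (ENNReal.mul_ne_top (ENNReal.inv_ne_top.2 hB0) hI)
      exact (ENNReal.mul_le_mul_iff_right hbne hbtop).1 h3
  refine ⟨{z | ‖f z‖ₑ^2 ≤ b0} ∩ (ω ∩ B), hGm.inter hωB,
    Set.inter_subset_right.trans Set.inter_subset_right, ?_, fun z hz => hz.1⟩
  have hsum : volume (ω ∩ B) ≤ volume ({z | ‖f z‖ₑ^2 ≤ b0} ∩ (ω ∩ B)) +
      volume ({z | ‖f z‖ₑ^2 ≤ b0}ᶜ ∩ (ω ∩ B)) := by
    refine le_trans (measure_mono ?_) (measure_union_le _ _)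
    intro z hz
    by_cases h : z ∈ {z | ‖f z‖ₑ^2 ≤ b0}
    · exact Or.inl ⟨h, hz⟩
    · exact Or.inr ⟨h, hz⟩
  have h4 : ENNReal.ofReal γ * volume B = ENNReal.ofReal (γ/2) * volume B
      + ENNReal.ofReal (γ/2) * volume B := by
    rw [← add_mul, ← ENNReal.ofReal_add (by positivity) (by positivity), add_halves]
  have h5 := hthick.trans (hsum.trans (add_le_add le_rfl hm))
  rw [h4] at h5
  exact (ENNReal.add_le_add_iff_right (ENNReal.mul_ne_top ENNReal.ofReal_ne_top hBfin)).1 h5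

lemma one_dim_enn (h : ℝ → ℂ) (hh : ContDiff ℝ (⊤ : ℕ∞) h) (n : ℕ) (F : Set ℝ)
    (hF : MeasurableSet F) (hF1 : F ⊆ Set.Icc 0 1) (c : ℝ)
    (hc : 0 < c) (hc1 : c ≤ 1) (hvol : ENNReal.ofReal c ≤ volume F) (b : ℝ≥0∞) (hbtop : b ≠ ∞)
    (hB : ∀ θ ∈ F, ‖h θ‖ₑ^2 ≤ b) :
    ‖h 0‖ₑ^2 ≤ ENNReal.ofReal (2 * (12 / c) ^ (2 * (n+1))) *
      (b + ENNReal.ofReal ((1 / (n.factorial : ℝ))^2) *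
        ∫⁻ s in Set.Icc (0:ℝ) 1, ‖iteratedDeriv (n+1) h s‖ₑ^2) := by
  have hcont : Continuous (iteratedDeriv (n+1) h) :=
    hh.continuous_iteratedDeriv _ (by exact_mod_cast le_top)
  have h1 := one_dim h hh n F hF hF1 c hc hc1 hvol (Real.sqrt b.toReal) (by
    intro θ hθ
    apply Real.le_sqrt_of_sq_le
    have := ENNReal.toReal_mono hbtop (hB θ hθ)
    simpa using this)
  have integI : Integrable (fun s => iteratedDeriv (n+1) h s) (volume.restrict (Set.Icc (0:ℝ) 1)) :=
    hcont.continuousOn.integrableOn_Icc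
  have hJ : ENNReal.ofReal (∫ s in Set.Icc (0:ℝ) 1, ‖iteratedDeriv (n+1) h s‖) =
      ∫⁻ s in Set.Icc (0:ℝ) 1, ‖iteratedDeriv (n+1) h s‖ₑ :=
    ofReal_integral_norm_eq_lintegral_enorm integI
  have hJ0 : 0 ≤ ∫ s in Set.Icc (0:ℝ) 1, ‖iteratedDeriv (n+1) h s‖ :=
    integral_nonneg fun _ => norm_nonneg _
  have h2 := ENNReal.ofReal_le_ofReal h1
  rw [ofReal_norm, ENNReal.ofReal_mul (by positivity),
    ENNReal.ofReal_add (by positivity) (by positivity), ENNReal.ofReal_mul (by positivity), hJ] at h2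
  calc ‖h 0‖ₑ^2 ≤ (ENNReal.ofReal ((12 / c) ^ (n+1)) * (ENNReal.ofReal (Real.sqrt b.toReal) +
        ENNReal.ofReal (1 / (n.factorial:ℝ)) * ∫⁻ s in Set.Icc (0:ℝ) 1, ‖iteratedDeriv (n+1) h s‖ₑ))^2 := by
        gcongr
    _ ≤ (ENNReal.ofReal ((12 / c) ^ (n+1)))^2 * (2 * (ENNReal.ofReal (Real.sqrt b.toReal)^2 +
        (ENNReal.ofReal (1 / (n.factorial:ℝ)) * ∫⁻ s in Set.Icc (0:ℝ) 1, ‖iteratedDeriv (n+1) h s‖ₑ)^2)) := by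
        rw [mul_pow]
        gcongr
        exact enn_add_sq _ _
    _ ≤ (ENNReal.ofReal ((12 / c) ^ (n+1)))^2 * (2 * (b +
        ENNReal.ofReal ((1 / (n.factorial : ℝ))^2) *
        ∫⁻ s in Set.Icc (0:ℝ) 1, ‖iteratedDeriv (n+1) h s‖ₑ^2)) := by
        gcongr
        · rw [← ENNReal.ofReal_pow (Real.sqrt_nonneg _), Real.sq_sqrt ENNReal.toReal_nonneg]
          exact ENNReal.ofReal_toReal_le
        · rw [mul_pow, ENNReal.ofReal_pow (by positivity)]
          gcongr
          exact enn_jensen _ hcont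
    _ = _ := by
        rw [← mul_assoc]
        congr 1
        rw [ENNReal.ofReal_mul (by norm_num), ← ENNReal.ofReal_pow (by positivity), ← pow_mul,
          mul_comm (n+1) 2, mul_comm]
        simp

lemma pointwise_bound {d : ℕ} (hd : 1 ≤ d) (f : Esp d → ℂ) (hf : ContDiff ℝ (⊤ : ℕ∞) f) (n : ℕ)
    (x : Esp d) (r : ℝ) (hr : 0 < r)
    (ω : Set (Esp d)) (hω : MeasurableSet ω) (γ : ℝ) (hγ0 : 0 < γ) (hγ1 : γ ≤ 1)
    (hthick : ENNReal.ofReal γ * volume (Metric.ball x r) ≤ volume (ω ∩ Metric.ball x r))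
    (u : Esp d → ℝ≥0∞) (hum : Measurable u)
    (hu : ∀ y ∈ Metric.ball x r, ∀ θ ∈ Set.Icc (0:ℝ) 1,
      ‖iteratedDeriv (n+1) (fun s : ℝ => f (x + s • (y - x))) θ‖ₑ^2 ≤ u (x + θ • (y - x)))
    (c : ℝ) (hc : c = (γ/2)^2 / (8 * d)) :
    ‖f x‖ₑ^2 ≤ ENNReal.ofReal (2 * (12 / c) ^ (2 * (n+1))) *
      (ENNReal.ofReal (2/γ) * ((volume (Metric.ball x r))⁻¹ *
          ∫⁻ z in ω ∩ Metric.ball x r, ‖f z‖ₑ^2)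
        + ENNReal.ofReal ((1 / (n.factorial : ℝ))^2 / c) * ((volume (Metric.ball x r))⁻¹ *
          ∫⁻ y in Metric.ball x r, ∫⁻ θ in Set.Icc (0:ℝ) 1, u (x + θ • (y - x)))) := by
  have hd' : (1:ℝ) ≤ d := by exact_mod_cast hd
  have hc0 : 0 < c := by rw [hc]; positivity
  have hc1 : c ≤ 1 := by
    rw [hc, div_le_one (by positivity)]; nlinarith
  have hB0 : volume (Metric.ball x r) ≠ 0 := (Metric.measure_ball_pos volume x hr).ne'
  have hBfin : volume (Metric.ball x r) ≠ ∞ := measure_ball_lt_top.ne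
  by_cases hI : ∫⁻ z in ω ∩ Metric.ball x r, ‖f z‖ₑ^2 = ∞
  · rw [hI, ENNReal.mul_top (ENNReal.inv_ne_zero.2 hBfin), ENNReal.mul_top (by
      simp; positivity), top_add, ENNReal.mul_top (by simp; positivity)]
    exact le_top
  obtain ⟨G, hGm, hGs, hGv, hGb⟩ := markov_set f hf.continuous x r hr ω hω γ hγ0 hthick hI
  obtain ⟨Y, hYm, hYs, hYv, hYb⟩ := good_dirs x r hr G hGm hGs (γ/2) (by positivity) (by linarith)
    hd hGv
  rw [← hc] at hYv hYb
  set b := ENNReal.ofReal (2/γ) * ((volume (Metric.ball x r))⁻¹ *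
          ∫⁻ z in ω ∩ Metric.ball x r, ‖f z‖ₑ^2) with hb
  have hbtop : b ≠ ∞ := ENNReal.mul_ne_top ENNReal.ofReal_ne_top
          (ENNReal.mul_ne_top (ENNReal.inv_ne_top.2 hB0) hI)
  set k : Esp d → ℝ≥0∞ := fun y => ∫⁻ θ in Set.Icc (0:ℝ) 1, u (x + θ • (y - x)) with hk
  have hline : Measurable fun p : Esp d × ℝ => x + p.2 • (p.1 - x) := by
    apply Continuous.measurable; fun_prop
  have hkm : Measurable k := (hum.comp hline).lintegral_prod_right'
  have hYpos : ENNReal.ofReal c * volume (Metric.ball x r) ≠ 0 :=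
    mul_ne_zero (by simpa using hc0) hB0
  have hY0 : volume Y ≠ 0 := fun h => hYpos (le_antisymm (h ▸ hYv) bot_le)
  have hYfin : volume Y ≠ ∞ := ne_top_of_le_ne_top hBfin (measure_mono hYs)
  obtain ⟨y, hy, hyk⟩ := exists_le_setLAverage hY0 hYfin hkm.aemeasurable
  have hk2 : k y ≤ (ENNReal.ofReal c * volume (Metric.ball x r))⁻¹ * ∫⁻ y in Metric.ball x r, k y := by
    refine hyk.trans ?_
    rw [setLAverage_eq, div_eq_mul_inv, mul_comm]
    gcongr
  have hsm : ContDiff ℝ (⊤ : ℕ∞) (fun s : ℝ => f (x + s • (y - x))) := by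
    apply hf.comp; fun_prop
  have h1 := one_dim_enn (fun s : ℝ => f (x + s • (y - x))) hsm n
    {θ : ℝ | θ ∈ Set.Icc (0:ℝ) 1 ∧ x + θ • (y - x) ∈ G}
    (measurableSet_Icc.inter (by
      have : Measurable fun s : ℝ => x + s • (y - x) := by
        apply Continuous.measurable; fun_prop
      exact this hGm)) (fun θ h => h.1) c hc0 hc1 (hYb y hy) b hbtop (fun θ h => hGb _ h.2)
  simp only [zero_smul, add_zero] at h1
  refine h1.trans ?_
  refine mul_le_mul_right (add_le_add le_rfl ?_) _
  calc ENNReal.ofReal ((1 / (n.factorial:ℝ))^2) *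
        ∫⁻ s in Set.Icc (0:ℝ) 1, ‖iteratedDeriv (n+1) (fun s : ℝ => f (x + s • (y - x))) s‖ₑ^2
      ≤ ENNReal.ofReal ((1 / (n.factorial:ℝ))^2) * k y := by
        gcongr
        exact setLIntegral_mono' measurableSet_Icc fun θ hθ => hu y (hYs hy) θ hθ
    _ ≤ ENNReal.ofReal ((1 / (n.factorial:ℝ))^2) *
        ((ENNReal.ofReal c * volume (Metric.ball x r))⁻¹ * ∫⁻ y in Metric.ball x r, k y) := by
        gcongr
    _ = ENNReal.ofReal ((1 / (n.factorial : ℝ))^2 / c) * ((volume (Metric.ball x r))⁻¹ *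
          ∫⁻ y in Metric.ball x r, k y) := by
        rw [ENNReal.mul_inv (Or.inr hBfin) (Or.inr hB0),
          div_eq_mul_inv ((1 / (n.factorial:ℝ))^2) c, ENNReal.ofReal_mul (by positivity),
          ENNReal.ofReal_inv_of_pos hc0]
        ring


lemma vol_ball_formula {d : ℕ} (x : Esp d) (r : ℝ) (hr : 0 < r) :
    volume (Metric.ball x r) = ENNReal.ofReal (r ^ d) * volume (Metric.ball (0 : Esp d) 1) := by
  rw [Measure.addHaar_ball_of_pos volume x hr]
  simp

lemma avg_bound {d : ℕ} (r : Esp d → ℝ) (hr : ∀ x, 0 < r x) (L : ℝ) (hL0 : 0 ≤ L) (hL1 : L < 1)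
    (hLip : ∀ x y, |r x - r y| ≤ L * ‖x - y‖) (hrm : Measurable r)
    (u : Esp d → ℝ≥0∞) (hu : Measurable u) :
    ∫⁻ x, (volume (Metric.ball x (r x)))⁻¹ * ∫⁻ z in Metric.ball x (r x), u z ≤
      ENNReal.ofReal (((1 + L) / (1 - L)) ^ d) * ∫⁻ z, u z := by
  have hL' : 0 < 1 - L := by linarith
  set w := volume (Metric.ball (0 : Esp d) 1) with hw
  have hw0 : w ≠ 0 := (Metric.measure_ball_pos volume _ one_pos).ne'
  have hwt : w ≠ ∞ := measure_ball_lt_top.ne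
  set a : Esp d → ℝ≥0∞ := fun x => (volume (Metric.ball x (r x)))⁻¹ with ha
  have ham : Measurable a := by
    have : a = fun x => (ENNReal.ofReal (r x ^ d) * w)⁻¹ := by
      funext x; rw [ha]; simp only; rw [vol_ball_formula x _ (hr x)]
    rw [this]; fun_prop
  set D : Set (Esp d × Esp d) := {p | dist p.2 p.1 < r p.1} with hD
  have hDm : MeasurableSet D := measurableSet_lt (by fun_prop) (by fun_prop)
  set F : Esp d → Esp d → ℝ≥0∞ := fun x z => D.indicator (fun p => a p.1 * u p.2) (x, z) with hF
  have hFm : Measurable (Function.uncurry F) := by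
    have : Measurable (D.indicator (fun p : Esp d × Esp d => a p.1 * u p.2)) :=
      Measurable.indicator (by fun_prop) hDm
    exact this
  have h1 : ∀ x, a x * ∫⁻ z in Metric.ball x (r x), u z = ∫⁻ z, F x z := by
    intro x
    rw [← lintegral_const_mul _ hu, ← lintegral_indicator measurableSet_ball]
    refine lintegral_congr fun z => ?_
    simp only [hF, Set.indicator, hD, Metric.mem_ball]
    rfl
  calc ∫⁻ x, a x * ∫⁻ z in Metric.ball x (r x), u z = ∫⁻ x, ∫⁻ z, F x z := lintegral_congr h1
    _ = ∫⁻ z, ∫⁻ x, F x z := lintegral_lintegral_swap hFm.aemeasurable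
    _ ≤ ∫⁻ z, ENNReal.ofReal (((1 + L) / (1 - L)) ^ d) * u z := by
      refine lintegral_mono fun z => ?_
      have h2 : ∀ x, F x z ≤ (Metric.ball z (r z / (1 - L))).indicator
          (fun _ => (volume (Metric.ball z (r z / (1 + L))))⁻¹ * u z) x := by
        intro x
        by_cases hx : (x, z) ∈ D
        · have hx' : dist z x < r x := hx
          have hn : ‖x - z‖ < r x := by rwa [dist_comm, dist_eq_norm] at hx'
          have h3 := abs_le.1 (hLip x z)
          have h4 : r x * (1 - L) ≤ r z := by nlinarith [h3.1, h3.2, norm_nonneg (x - z)]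
          have h5 : r z ≤ (1 + L) * r x := by nlinarith [h3.1, h3.2, norm_nonneg (x - z)]
          have hxb : x ∈ Metric.ball z (r z / (1 - L)) := by
            rw [Metric.mem_ball, dist_comm]
            exact hx'.trans_le ((le_div_iff₀ hL').2 h4)
          rw [Set.indicator_of_mem hxb, hF]
          simp only
          rw [Set.indicator_of_mem hx]
          simp only [ha]
          gcongr ?_⁻¹ * _
          rw [vol_ball_formula x _ (hr x), vol_ball_formula z _ (by have := hr z; positivity)]
          gcongr
          · have := hr z; positivity
          · rw [div_le_iff₀ (by positivity)]; linarith
        · rw [hF]; simp only; rw [Set.indicator_of_notMem hx]; exact bot_le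
      refine (lintegral_mono h2).trans ?_
      rw [lintegral_indicator_const measurableSet_ball, mul_right_comm]
      gcongr
      have hz := hr z
      rw [vol_ball_formula z _ (by positivity), vol_ball_formula z _ (by positivity),
        ENNReal.mul_inv (Or.inr hwt) (Or.inr hw0), ← ENNReal.ofReal_inv_of_pos (by positivity)]
      calc _ = ENNReal.ofReal (((r z / (1 + L)) ^ d)⁻¹) * ENNReal.ofReal ((r z / (1 - L)) ^ d) *
            (w⁻¹ * w) := by ring
        _ ≤ ENNReal.ofReal (((1 + L) / (1 - L)) ^ d) := by
          rw [ENNReal.inv_mul_cancel hw0 hwt, mul_one, ← ENNReal.ofReal_mul (by positivity)]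
          apply le_of_eq
          congr 1
          rw [← inv_pow, ← mul_pow]
          congr 1
          field_simp
    _ = _ := lintegral_const_mul _ hu

lemma avg_line {d : ℕ} (x : Esp d) (r θ : ℝ) (hr : 0 < r) (hθ : 0 < θ)
    (u : Esp d → ℝ≥0∞) (hu : Measurable u) :
    (volume (Metric.ball x r))⁻¹ * ∫⁻ y in Metric.ball x r, u (x + θ • (y - x)) =
      (volume (Metric.ball x (θ * r)))⁻¹ * ∫⁻ z in Metric.ball x (θ * r), u z := by
  have hφ : Measurable fun y : Esp d => x + θ • (y - x) := by
    apply Continuous.measurable; fun_prop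
  have hmap : Measure.map (fun y : Esp d => x + θ • (y - x)) volume =
      ENNReal.ofReal ((θ⁻¹) ^ d) • volume := by
    ext s hs
    rw [Measure.map_apply hφ hs]
    rw [Measure.smul_apply, smul_eq_mul]
    exact vol_preimage_line x θ hθ s
  have hpre : Metric.ball x r = (fun y : Esp d => x + θ • (y - x)) ⁻¹' Metric.ball x (θ * r) := by
    ext y
    simp only [Metric.mem_ball, Set.mem_preimage, dist_eq_norm, add_sub_cancel_left, norm_smul,
      Real.norm_eq_abs, abs_of_pos hθ]
    exact (mul_lt_mul_iff_right₀ hθ).symm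
  have h1 : ∫⁻ y in Metric.ball x r, u (x + θ • (y - x)) =
      ENNReal.ofReal ((θ⁻¹) ^ d) * ∫⁻ z in Metric.ball x (θ * r), u z := by
    rw [hpre, ← setLIntegral_map measurableSet_ball hu hφ, hmap, Measure.restrict_smul,
      lintegral_smul_measure, smul_eq_mul]
  have hB0 : volume (Metric.ball x r) ≠ 0 := (Metric.measure_ball_pos volume x hr).ne'
  have hBt : volume (Metric.ball x r) ≠ ∞ := measure_ball_lt_top.ne
  rw [h1, vol_ball_scale x r θ hθ, ENNReal.mul_inv (Or.inr hBt) (Or.inr hB0),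
    ← ENNReal.ofReal_inv_of_pos (by positivity), inv_pow]
  ring

lemma avg_double {d : ℕ} (ρ : Esp d → ℝ) (hr : ∀ x, 0 < ρ x) (L : ℝ) (hL0 : 0 ≤ L) (hL1 : L < 1)
    (hLip : ∀ x y, |ρ x - ρ y| ≤ L * ‖x - y‖) (hrm : Measurable ρ)
    (u : Esp d → ℝ≥0∞) (hu : Measurable u) :
    ∫⁻ x, (volume (Metric.ball x (ρ x)))⁻¹ *
        ∫⁻ y in Metric.ball x (ρ x), ∫⁻ θ in Set.Icc (0:ℝ) 1, u (x + θ • (y - x)) ≤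
      ENNReal.ofReal (((1 + L) / (1 - L)) ^ d) * ∫⁻ z, u z := by
  have ham : Measurable fun x => (volume (Metric.ball x (ρ x)))⁻¹ := by
    have : (fun x => (volume (Metric.ball x (ρ x)))⁻¹) =
        fun x => (ENNReal.ofReal (ρ x ^ d) * volume (Metric.ball (0 : Esp d) 1))⁻¹ := by
      funext x; rw [vol_ball_formula x _ (hr x)]
    rw [this]; fun_prop
  set G : Esp d → ℝ → ℝ≥0∞ := fun x θ => (volume (Metric.ball x (ρ x)))⁻¹ *
    ∫⁻ y in Metric.ball x (ρ x), u (x + θ • (y - x)) with hG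
  have hGm : Measurable (Function.uncurry G) := by
    have hD : MeasurableSet {p : (Esp d × ℝ) × Esp d | dist p.2 p.1.1 < ρ p.1.1} :=
      measurableSet_lt (by fun_prop) (by fun_prop)
    have hline : Measurable fun p : (Esp d × ℝ) × Esp d => p.1.1 + p.1.2 • (p.2 - p.1.1) := by
      apply Continuous.measurable; fun_prop
    have h1 : Measurable fun q : Esp d × ℝ => ∫⁻ y,
        ({p : (Esp d × ℝ) × Esp d | dist p.2 p.1.1 < ρ p.1.1}).indicator
          (fun p => u (p.1.1 + p.1.2 • (p.2 - p.1.1))) (q, y) :=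
      Measurable.lintegral_prod_right' (Measurable.indicator (hu.comp hline) hD)
    have h2 : Function.uncurry G = fun q : Esp d × ℝ => (volume (Metric.ball q.1 (ρ q.1)))⁻¹ * ∫⁻ y,
        ({p : (Esp d × ℝ) × Esp d | dist p.2 p.1.1 < ρ p.1.1}).indicator
          (fun p => u (p.1.1 + p.1.2 • (p.2 - p.1.1))) (q, y) := by
      funext q
      simp only [Function.uncurry, hG]
      congr 1
      rw [← lintegral_indicator measurableSet_ball]
      rfl
    rw [h2]
    exact (ham.comp measurable_fst).mul h1
  have hline2 : ∀ x : Esp d, Measurable fun p : Esp d × ℝ => u (x + p.2 • (p.1 - x)) := by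
    intro x
    refine hu.comp ?_
    apply Continuous.measurable; fun_prop
  calc _ = ∫⁻ x, ∫⁻ θ in Set.Icc (0:ℝ) 1, G x θ := by
        refine lintegral_congr fun x => ?_
        rw [lintegral_lintegral_swap (hline2 x).aemeasurable, ← lintegral_const_mul]
        exact Measurable.lintegral_prod_left' (hline2 x)
    _ = ∫⁻ θ in Set.Icc (0:ℝ) 1, ∫⁻ x, G x θ := lintegral_lintegral_swap hGm.aemeasurable
    _ = ∫⁻ θ in Set.Ioc (0:ℝ) 1, ∫⁻ x, G x θ := by
        rw [restrict_Ioc_eq_restrict_Icc]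
    _ ≤ ∫⁻ θ in Set.Ioc (0:ℝ) 1, ENNReal.ofReal (((1 + L) / (1 - L)) ^ d) * ∫⁻ z, u z := by
        refine setLIntegral_mono' measurableSet_Ioc fun θ hθ => ?_
        refine le_trans (le_of_eq ?_) (avg_bound (fun x => θ * ρ x) (fun x => mul_pos hθ.1 (hr x))
          L hL0 hL1 (fun x y => ?_) (by fun_prop) u hu)
        · exact lintegral_congr fun x => avg_line x (ρ x) θ (hr x) hθ.1 u hu
        · rw [← mul_sub, abs_mul, abs_of_pos hθ.1]
          calc θ * |ρ x - ρ y| ≤ 1 * |ρ x - ρ y| := by gcongr; exact hθ.2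
            _ ≤ _ := by rw [one_mul]; exact hLip x y
    _ = _ := by simp

lemma global_bound {d : ℕ} (hd : 1 ≤ d) (ρ : Esp d → ℝ) (hr : ∀ x, 0 < ρ x)
    (L : ℝ) (hL0 : 0 ≤ L) (hL1 : L < 1)
    (hLip : ∀ x y, |ρ x - ρ y| ≤ L * ‖x - y‖) (hrm : Measurable ρ)
    (ω : Set (Esp d)) (hω : MeasurableSet ω) (γ : ℝ) (hγ0 : 0 < γ) (hγ1 : γ ≤ 1)
    (hthick : ∀ x, ENNReal.ofReal γ * volume (Metric.ball x (ρ x)) ≤ volume (ω ∩ Metric.ball x (ρ x)))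
    (f : Esp d → ℂ) (hf : ContDiff ℝ (⊤ : ℕ∞) f) (n : ℕ)
    (u : Esp d → ℝ≥0∞) (hum : Measurable u)
    (hu : ∀ x, ∀ y ∈ Metric.ball x (ρ x), ∀ θ ∈ Set.Icc (0:ℝ) 1,
      ‖iteratedDeriv (n+1) (fun s : ℝ => f (x + s • (y - x))) θ‖ₑ^2 ≤ u (x + θ • (y - x)))
    (c : ℝ) (hc : c = (γ/2)^2 / (8 * d)) :
    ∫⁻ x, ‖f x‖ₑ^2 ≤ ENNReal.ofReal (2 * (12 / c) ^ (2 * (n+1))) *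
      (ENNReal.ofReal (2/γ) * (ENNReal.ofReal (((1 + L) / (1 - L)) ^ d) * ∫⁻ z in ω, ‖f z‖ₑ^2)
        + ENNReal.ofReal ((1 / (n.factorial : ℝ))^2 / c) *
          (ENNReal.ofReal (((1 + L) / (1 - L)) ^ d) * ∫⁻ z, u z)) := by
  have hfm : Measurable fun z => ‖f z‖ₑ^2 := by
    have := hf.continuous.measurable; fun_prop
  have hvm : Measurable (ω.indicator fun z => ‖f z‖ₑ^2) := hfm.indicator hω
  have ham : Measurable fun x => (volume (Metric.ball x (ρ x)))⁻¹ := by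
    have : (fun x => (volume (Metric.ball x (ρ x)))⁻¹) =
        fun x => (ENNReal.ofReal (ρ x ^ d) * volume (Metric.ball (0 : Esp d) 1))⁻¹ := by
      funext x; rw [vol_ball_formula x _ (hr x)]
    rw [this]; fun_prop
  have hA : ∀ x, ∫⁻ z in ω ∩ Metric.ball x (ρ x), ‖f z‖ₑ^2 =
      ∫⁻ z in Metric.ball x (ρ x), ω.indicator (fun z => ‖f z‖ₑ^2) z := by
    intro x
    rw [lintegral_indicator hω, Measure.restrict_restrict hω]
  have hPm : Measurable fun x => (volume (Metric.ball x (ρ x)))⁻¹ *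
      ∫⁻ z in ω ∩ Metric.ball x (ρ x), ‖f z‖ₑ^2 := by
    refine ham.mul ?_
    have hD : MeasurableSet {p : Esp d × Esp d | dist p.2 p.1 < ρ p.1} :=
      measurableSet_lt (by fun_prop) (by fun_prop)
    have h1 : Measurable fun x : Esp d => ∫⁻ z,
        ({p : Esp d × Esp d | dist p.2 p.1 < ρ p.1}).indicator
          (fun p => ω.indicator (fun z => ‖f z‖ₑ^2) p.2) (x, z) :=
      Measurable.lintegral_prod_right' (Measurable.indicator (hvm.comp measurable_snd) hD)
    convert h1 using 2 with x
    rw [hA, ← lintegral_indicator measurableSet_ball]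
    rfl
  calc ∫⁻ x, ‖f x‖ₑ^2 ≤ ∫⁻ x, ENNReal.ofReal (2 * (12 / c) ^ (2 * (n+1))) *
      (ENNReal.ofReal (2/γ) * ((volume (Metric.ball x (ρ x)))⁻¹ *
          ∫⁻ z in ω ∩ Metric.ball x (ρ x), ‖f z‖ₑ^2)
        + ENNReal.ofReal ((1 / (n.factorial : ℝ))^2 / c) * ((volume (Metric.ball x (ρ x)))⁻¹ *
          ∫⁻ y in Metric.ball x (ρ x), ∫⁻ θ in Set.Icc (0:ℝ) 1, u (x + θ • (y - x)))) :=
        lintegral_mono fun x => pointwise_bound hd f hf n x (ρ x) (hr x) ω hω γ hγ0 hγ1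
          (hthick x) u hum (hu x) c hc
    _ = ENNReal.ofReal (2 * (12 / c) ^ (2 * (n+1))) *
      (ENNReal.ofReal (2/γ) * (∫⁻ x, (volume (Metric.ball x (ρ x)))⁻¹ *
          ∫⁻ z in ω ∩ Metric.ball x (ρ x), ‖f z‖ₑ^2)
        + ENNReal.ofReal ((1 / (n.factorial : ℝ))^2 / c) * (∫⁻ x, (volume (Metric.ball x (ρ x)))⁻¹ *
          ∫⁻ y in Metric.ball x (ρ x), ∫⁻ θ in Set.Icc (0:ℝ) 1, u (x + θ • (y - x)))) := by
        rw [lintegral_const_mul' _ _ ENNReal.ofReal_ne_top, lintegral_add_left (hPm.const_mul _),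
          lintegral_const_mul' _ _ ENNReal.ofReal_ne_top,
          lintegral_const_mul' _ _ ENNReal.ofReal_ne_top]
    _ ≤ _ := by
        gcongr
        · simp only [hA]
          refine (avg_bound ρ hr L hL0 hL1 hLip hrm _ hvm).trans ?_
          rw [lintegral_indicator hω]
        · exact avg_double ρ hr L hL0 hL1 hLip hrm u hum


lemma pderivI_smooth {d : ℕ} (i : Fin d) (f : Esp d → ℂ) (hf : ContDiff ℝ (⊤ : ℕ∞) f) :
    ContDiff ℝ (⊤ : ℕ∞) (pderivI i f) := by
  unfold pderivI
  have h1 : ContDiff ℝ (⊤ : ℕ∞) (fderiv ℝ f) := hf.fderiv_right (by simp)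
  exact h1.clm_apply contDiff_const

lemma pderivI_comm {d : ℕ} (i j : Fin d) (f : Esp d → ℂ) (hf : ContDiff ℝ (⊤ : ℕ∞) f) :
    pderivI i (pderivI j f) = pderivI j (pderivI i f) := by
  have h1 : ContDiff ℝ (⊤ : ℕ∞) (fderiv ℝ f) := hf.fderiv_right (by simp)
  funext x
  have h2 : ∀ k : Fin d, ∀ v, fderiv ℝ (fun y => fderiv ℝ f y (EuclideanSpace.single k 1)) x v =
      fderiv ℝ (fderiv ℝ f) x v (EuclideanSpace.single k 1) := by
    intro k v
    have h3 := (h1.differentiable (by simp)).differentiableAt (x := x)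
    rw [fderiv_clm_apply h3 (differentiableAt_const _)]
    simp
  unfold pderivI
  rw [h2, h2]
  have hs : IsSymmSndFDerivAt ℝ f x :=
    hf.contDiffAt.isSymmSndFDerivAt (by
      simp only [minSmoothness_of_isRCLikeNormedField]
      exact WithTop.coe_le_coe.2 (le_top : (2:ℕ∞) ≤ ⊤))
  exact hs _ _

/-- Sum of the moduli of all (ordered) partial derivatives of order `N`. -/
def Wd {d : ℕ} : ℕ → (Esp d → ℂ) → Esp d → ℝ
  | 0, f => fun z => ‖f z‖
  | N + 1, f => fun z => ∑ i, Wd N (pderivI i f) z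

lemma Wd_continuous {d : ℕ} (N : ℕ) : ∀ f : Esp d → ℂ, ContDiff ℝ (⊤ : ℕ∞) f →
    Continuous (Wd N f) := by
  induction N with
  | zero => intro f hf; exact hf.continuous.norm
  | succ N ih =>
    intro f hf
    exact continuous_finsetSum _ fun i _ => ih _ (pderivI_smooth i f hf)

lemma Wd_nonneg {d : ℕ} (N : ℕ) : ∀ (f : Esp d → ℂ) (z : Esp d), 0 ≤ Wd N f z := by
  induction N with
  | zero => intro f z; exact norm_nonneg _
  | succ N ih => intro f z; exact Finset.sum_nonneg fun i _ => ih _ z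

lemma deriv_line {d : ℕ} (f : Esp d → ℂ) (hf : ContDiff ℝ (⊤ : ℕ∞) f) (x v : Esp d) :
    deriv (fun s : ℝ => f (x + s • v)) = fun s => ∑ i, (v i : ℂ) * pderivI i f (x + s • v) := by
  funext s
  have h1 : HasDerivAt (fun s : ℝ => x + s • v) v s := by
    simpa using ((hasDerivAt_id s).smul_const v).const_add x
  have h2 : HasFDerivAt f (fderiv ℝ f (x + s • v)) (x + s • v) :=
    ((hf.differentiable (by simp)).differentiableAt).hasFDerivAt
  have h3 := h2.comp_hasDerivAt s h1
  have h4 : deriv (fun s : ℝ => f (x + s • v)) s = fderiv ℝ f (x + s • v) v := h3.deriv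
  rw [h4]
  have h5 : v = ∑ i, v i • EuclideanSpace.single i (1:ℝ) := by
    ext j
    simp [Finset.sum_apply, Pi.single_apply]
  have h6 : fderiv ℝ f (x + s • v) v =
      fderiv ℝ f (x + s • v) (∑ i, v i • EuclideanSpace.single i (1:ℝ)) := by rw [← h5]
  rw [h6, map_sum]
  refine Finset.sum_congr rfl fun i _ => ?_
  rw [map_smul]
  simp [pderivI]

lemma iter_line {d : ℕ} (x v : Esp d) (r : ℝ) (hv : ‖v‖ ≤ r) (N : ℕ) :
    ∀ f : Esp d → ℂ, ContDiff ℝ (⊤ : ℕ∞) f → ∀ θ : ℝ,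
      ‖iteratedDeriv N (fun s : ℝ => f (x + s • v)) θ‖ ≤ r ^ N * Wd N f (x + θ • v) := by
  induction N with
  | zero => intro f hf θ; simp [Wd]
  | succ N ih =>
    intro f hf θ
    have hr : 0 ≤ r := (norm_nonneg v).trans hv
    have hsm : ∀ i, ContDiff ℝ (⊤ : ℕ∞) (fun s : ℝ => pderivI i f (x + s • v)) := by
      intro i
      apply (pderivI_smooth i f hf).comp; fun_prop
    rw [iteratedDeriv_succ', deriv_line f hf]
    rw [iteratedDeriv_fun_sum (fun i _ => by
      apply ContDiffAt.mul contDiffAt_const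
      exact ((hsm i).of_le (by exact_mod_cast le_top)).contDiffAt)]
    refine (norm_sum_le _ _).trans ?_
    simp only [Wd]
    rw [Finset.mul_sum]
    refine Finset.sum_le_sum fun i _ => ?_
    rw [iteratedDeriv_const_mul_field, norm_mul]
    have h1 : ‖((v i : ℝ) : ℂ)‖ ≤ r := by
      rw [Complex.norm_real]
      exact (PiLp.norm_apply_le v i).trans hv
    calc _ ≤ r * (r ^ N * Wd N (pderivI i f) (x + θ • v)) := by
          gcongr
          exact ih _ (pderivI_smooth i f hf) θ
      _ = _ := by ring

lemma iter_pderivI_smooth {d : ℕ} (i : Fin d) (k : ℕ) : ∀ f : Esp d → ℂ,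
    ContDiff ℝ (⊤ : ℕ∞) f → ContDiff ℝ (⊤ : ℕ∞) ((pderivI i)^[k] f) := by
  induction k with
  | zero => intro f hf; exact hf
  | succ k ih => intro f hf; exact ih _ (pderivI_smooth i f hf)

lemma iter_pderivI_comm {d : ℕ} (i j : Fin d) (k : ℕ) : ∀ f : Esp d → ℂ,
    ContDiff ℝ (⊤ : ℕ∞) f →
    pderivI i ((pderivI j)^[k] f) = (pderivI j)^[k] (pderivI i f) := by
  induction k with
  | zero => intro f hf; rfl
  | succ k ih =>
    intro f hf
    rw [Function.iterate_succ_apply, ih _ (pderivI_smooth j f hf), pderivI_comm i j f hf,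
      Function.iterate_succ_apply]

lemma foldr_smooth {d : ℕ} (β : Fin d → ℕ) (f : Esp d → ℂ) (hf : ContDiff ℝ (⊤ : ℕ∞) f)
    (l : List (Fin d)) :
    ContDiff ℝ (⊤ : ℕ∞) (l.foldr (fun i g => (pderivI i)^[β i] g) f) := by
  induction l with
  | nil => exact hf
  | cons j l ih => exact iter_pderivI_smooth j _ _ ih

lemma foldr_notMem {d : ℕ} (β : Fin d → ℕ) (i : Fin d) (f : Esp d → ℂ) (l : List (Fin d)) :
    i ∉ l → l.foldr (fun j g => (pderivI j)^[(β + Pi.single i 1 : Fin d → ℕ) j] g) f =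
      l.foldr (fun j g => (pderivI j)^[β j] g) f := by
  induction l with
  | nil => intro _; rfl
  | cons j l ih =>
    intro h
    rw [List.mem_cons, not_or] at h
    rw [List.foldr_cons, List.foldr_cons, ih h.2]
    have : (β + Pi.single i 1 : Fin d → ℕ) j = β j := by
      simp [Ne.symm h.1]
    rw [this]

lemma foldr_mem {d : ℕ} (β : Fin d → ℕ) (i : Fin d) (f : Esp d → ℂ)
    (hf : ContDiff ℝ (⊤ : ℕ∞) f) (l : List (Fin d)) :
    l.Nodup → i ∈ l → l.foldr (fun j g => (pderivI j)^[(β + Pi.single i 1 : Fin d → ℕ) j] g) f =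
      pderivI i (l.foldr (fun j g => (pderivI j)^[β j] g) f) := by
  induction l with
  | nil => intro _ h; simp at h
  | cons j l ih =>
    intro hn h
    rw [List.nodup_cons] at hn
    rw [List.foldr_cons, List.foldr_cons]
    by_cases hij : i = j
    · subst hij
      rw [foldr_notMem β i f l hn.1]
      have : (β + Pi.single i 1 : Fin d → ℕ) i = β i + 1 := by simp
      rw [this, Function.iterate_succ_apply']
    · have hl : i ∈ l := by
        rcases List.mem_cons.1 h with h | h
        · exact absurd h hij
        · exact h
      rw [ih hn.2 hl, iter_pderivI_comm i j _ _ (foldr_smooth β f hf l)]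
      have : (β + Pi.single i 1 : Fin d → ℕ) j = β j := by
        simp [Ne.symm hij]
      rw [this]

lemma mderiv_smooth {d : ℕ} (β : Fin d → ℕ) (f : Esp d → ℂ) (hf : ContDiff ℝ (⊤ : ℕ∞) f) :
    ContDiff ℝ (⊤ : ℕ∞) (mderiv β f) := by
  unfold mderiv
  rw [Fin.foldr_eq_foldr_finRange]
  exact foldr_smooth β f hf _

lemma pderivI_mderiv {d : ℕ} (β : Fin d → ℕ) (i : Fin d) (f : Esp d → ℂ)
    (hf : ContDiff ℝ (⊤ : ℕ∞) f) : pderivI i (mderiv β f) = mderiv (β + Pi.single i 1) f := by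
  unfold mderiv
  rw [Fin.foldr_eq_foldr_finRange, Fin.foldr_eq_foldr_finRange]
  exact (foldr_mem β i f hf _ (List.nodup_finRange d) (List.mem_finRange i)).symm

lemma mderiv_zero {d : ℕ} (f : Esp d → ℂ) : mderiv 0 f = f := by
  unfold mderiv
  rw [Fin.foldr_eq_foldr_finRange]
  generalize List.finRange d = l
  induction l with
  | nil => rfl
  | cons j l ih => rw [List.foldr_cons, ih]; rfl

lemma Wd_Lp {d : ℕ} (w : Esp d → ℝ) (hw : Continuous w) (f : Esp d → ℂ)
    (hf : ContDiff ℝ (⊤ : ℕ∞) f) (M : ℝ≥0∞) (N : ℕ) : ∀ β : Fin d → ℕ,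
    (∀ β' : Fin d → ℕ, ∑ i, β' i = ∑ i, β i + N →
      eLpNorm (fun z => w z * ‖mderiv β' f z‖) 2 volume ≤ M) →
    eLpNorm (fun z => w z * Wd N (mderiv β f) z) 2 volume ≤ (d:ℝ≥0∞) ^ N * M := by
  induction N with
  | zero =>
    intro β h
    simpa [Wd] using h β (by simp)
  | succ N ih =>
    intro β h
    have h1 : (fun z => w z * Wd (N+1) (mderiv β f) z) =
        ∑ i, fun z => w z * Wd N (mderiv (β + Pi.single i 1) f) z := by
      funext z
      simp only [Wd, Finset.sum_apply, Finset.mul_sum]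
      refine Finset.sum_congr rfl fun i _ => ?_
      rw [pderivI_mderiv β i f hf]
    rw [h1]
    refine (eLpNorm_sum_le (fun i _ => ?_) (by norm_num)).trans ?_
    · exact (hw.mul (Wd_continuous N _ (mderiv_smooth _ f hf))).aestronglyMeasurable
    · refine (Finset.sum_le_sum fun i _ => ih (β + Pi.single i 1) fun β' hβ' => h β' ?_).trans ?_
      · rw [hβ']
        simp [Finset.sum_add_distrib]
        ring
      · simp
        rw [pow_succ]
        apply le_of_eq; ring


lemma jap_pow_le {d : ℕ} (hd : 1 ≤ d) (z : Esp d) (p : ℕ) :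
    jap z ^ p ≤ ((d:ℝ) + 1) ^ p * (1 + ∑ i, |z i| ^ p) := by
  have : Nonempty (Fin d) := ⟨⟨0, hd⟩⟩
  obtain ⟨i, hi⟩ := Finite.exists_max (fun i : Fin d => |z i|)
  have hd' : (1:ℝ) ≤ d := by exact_mod_cast hd
  have hnorm : ‖z‖ ^ 2 ≤ d * |z i| ^ 2 := by
    rw [EuclideanSpace.norm_sq_eq]
    calc ∑ j, ‖z j‖ ^ 2 ≤ ∑ j : Fin d, |z i| ^ 2 := by
          refine Finset.sum_le_sum fun j _ => ?_
          rw [Real.norm_eq_abs]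
          have := hi j
          gcongr
      _ = _ := by simp
  have hj : ∀ M : ℝ, 1 ≤ M → |z i| ≤ M → jap z ≤ (d + 1) * M := by
    intro M hM hz
    unfold jap
    apply Real.sqrt_le_iff.2
    refine ⟨by positivity, ?_⟩
    have h1 : |z i| ^ 2 ≤ M ^ 2 := by gcongr
    have h2 : 1 ≤ M ^ 2 := by nlinarith
    have h3 : (d:ℝ) * |z i| ^ 2 ≤ d * M ^ 2 := by gcongr
    have h4 : (d + 1) * M ^ 2 ≤ ((d + 1) * M) ^ 2 := by
      rw [mul_pow]
      gcongr
      nlinarith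
    linarith
  have hj0 : 0 ≤ jap z := Real.sqrt_nonneg _
  have hsum : |z i| ^ p ≤ ∑ i, |z i| ^ p :=
    Finset.single_le_sum (f := fun i => |z i| ^ p) (fun _ _ => by positivity) (Finset.mem_univ i)
  rcases le_total (|z i|) 1 with h | h
  · calc jap z ^ p ≤ ((d + 1) * 1) ^ p := by
          have := hj 1 le_rfl h
          gcongr
      _ = ((d:ℝ) + 1) ^ p * 1 := by rw [mul_one, mul_one]
      _ ≤ _ := by
        gcongr
        have : 0 ≤ |z i| ^ p := by positivity
        linarith
  · calc jap z ^ p ≤ ((d + 1) * |z i|) ^ p := by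
          have := hj |z i| h le_rfl
          gcongr
      _ = ((d:ℝ) + 1) ^ p * |z i| ^ p := by rw [mul_pow]
      _ ≤ _ := by
        gcongr
        linarith

lemma weight_Lp {d : ℕ} (hd : 1 ≤ d) (F : Esp d → ℂ) (hF : Continuous F) (p : ℕ) (Q : ℝ≥0∞)
    (h0 : eLpNorm F 2 volume ≤ Q)
    (hi : ∀ i : Fin d, eLpNorm (fun z => ((z i ^ p : ℝ) : ℂ) * F z) 2 volume ≤ Q) :
    eLpNorm (fun z => jap z ^ p * ‖F z‖) 2 volume ≤ ((d:ℝ≥0∞) + 1) ^ (p+1) * Q := by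
  have hj0 : ∀ z : Esp d, 0 ≤ jap z := fun z => Real.sqrt_nonneg _
  have h1 : eLpNorm (fun z => jap z ^ p * ‖F z‖) 2 volume ≤
      ENNReal.ofReal (((d:ℝ) + 1) ^ p) * eLpNorm ((fun z => ‖F z‖) +
        ∑ i : Fin d, fun z => ‖((z i ^ p : ℝ) : ℂ) * F z‖) 2 volume := by
    apply eLpNorm_le_mul_eLpNorm_of_ae_le_mul
    refine ae_of_all _ fun z => ?_
    rw [Real.norm_eq_abs, abs_of_nonneg (by have := hj0 z; positivity), Real.norm_eq_abs]
    refine le_trans ?_ (mul_le_mul_of_nonneg_left (le_abs_self _) (by positivity))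
    have h2 : ((fun z => ‖F z‖) + ∑ i : Fin d, fun z => ‖((z i ^ p : ℝ) : ℂ) * F z‖) z =
        (1 + ∑ i, |z i| ^ p) * ‖F z‖ := by
      simp only [Pi.add_apply, Finset.sum_apply, norm_mul, Complex.norm_real, Real.norm_eq_abs,
        abs_pow]
      rw [add_mul, one_mul, Finset.sum_mul]
    rw [h2, ← mul_assoc]
    exact mul_le_mul_of_nonneg_right (jap_pow_le hd z p) (norm_nonneg _)
  have hc : ∀ i : Fin d, Continuous fun z : Esp d => ‖((z i ^ p : ℝ) : ℂ) * F z‖ := by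
    intro i; fun_prop
  have h3 : eLpNorm ((fun z => ‖F z‖) +
        ∑ i : Fin d, fun z => ‖((z i ^ p : ℝ) : ℂ) * F z‖) 2 volume ≤ ((d:ℝ≥0∞) + 1) * Q := by
    refine (eLpNorm_add_le hF.norm.aestronglyMeasurable ?_ (by norm_num)).trans ?_
    · exact Finset.aestronglyMeasurable_sum _ fun i _ => (hc i).aestronglyMeasurable
    · rw [add_comm, add_mul, one_mul]
      refine add_le_add ?_ ?_
      · refine (eLpNorm_sum_le (fun i _ => (hc i).aestronglyMeasurable) (by norm_num)).trans ?_
        refine (Finset.sum_le_sum (g := fun _ => Q) fun i _ => ?_).trans (by simp)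
        rw [eLpNorm_norm]; exact hi i
      · rw [eLpNorm_norm]; exact h0
  refine h1.trans ?_
  rw [pow_succ, mul_assoc]
  refine mul_le_mul' (le_of_eq ?_) h3
  rw [ENNReal.ofReal_pow (by positivity), ENNReal.ofReal_add (by positivity) (by positivity)]
  simp

lemma fact_bound (δ ν : ℝ) (hδ0 : 0 ≤ δ) (hν : 0 < ν) (N p : ℕ) (hN : 1 ≤ N)
    (hpN : p ≤ N) (hp : (p:ℝ) ≤ δ * N + 1) :
    (p.factorial : ℝ) ^ ν ≤ (Real.exp (ν + δ * ν)) ^ N * (N.factorial : ℝ) ^ (δ * ν) := by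
  have hN' : (1:ℝ) ≤ N := by exact_mod_cast hN
  have h1 : (p.factorial : ℝ) ≤ (N:ℝ) ^ (p:ℝ) := by
    rw [Real.rpow_natCast]
    have : p.factorial ≤ N ^ p := (Nat.factorial_le_pow p).trans (Nat.pow_le_pow_left hpN p)
    exact_mod_cast this
  have h2 : (N:ℝ) ^ (p:ℝ) ≤ (N:ℝ) ^ (δ * N + 1) := Real.rpow_le_rpow_of_exponent_le hN' hp
  have h3 : (N:ℝ) ^ (δ * N + 1) = ((N:ℝ) ^ N) ^ δ * N := by
    rw [Real.rpow_add (by positivity), Real.rpow_one, mul_comm δ, Real.rpow_mul (by positivity),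
      Real.rpow_natCast]
  have h4 : (N:ℝ) ^ N ≤ Real.exp N * N.factorial := by
    have := Real.pow_div_factorial_le_exp (N:ℝ) (by positivity) N
    rwa [div_le_iff₀ (by positivity)] at this
  have h5 : (N:ℝ) ≤ Real.exp N := by
    have := Real.add_one_le_exp (N:ℝ); linarith
  have h6 : (p.factorial : ℝ) ≤ (Real.exp N * N.factorial) ^ δ * Real.exp N := by
    refine h1.trans (h2.trans (h3.le.trans ?_))
    gcongr
  calc (p.factorial : ℝ) ^ ν ≤ ((Real.exp N * N.factorial) ^ δ * Real.exp N) ^ ν := by gcongr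
    _ = _ := by
      rw [Real.mul_rpow (by positivity) (by positivity), ← Real.rpow_mul (by positivity),
        Real.mul_rpow (by positivity) (by positivity), ← Real.exp_mul, ← Real.exp_mul,
        ← Real.exp_nat_mul, mul_right_comm, ← Real.exp_add]
      ring_nf

lemma deriv_est {d : ℕ} (hd : 1 ≤ d) (μ ν : ℝ) (hμ0 : 0 < μ) (hν : 0 < ν)
    (C : ℝ) (hC : 1 ≤ C) (r₁ : ℝ) (hr₁ : 0 < r₁) (r₂ : ℝ)
    (δ : ℝ) (hδ0 : 0 ≤ δ) (hδ1 : δ ≤ 1) (ρ : Esp d → ℝ) (hρpos : ∀ x, 0 < ρ x)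
    (hρcont : Continuous ρ) (L : ℝ) (hL1 : L < 1)
    (R : ℝ) (hR : 0 < R) (hρub : ∀ x, ρ x ≤ R * jap x ^ δ) :
    ∃ K : ℝ, 1 ≤ K ∧ ∀ t : ℝ, 0 < t → t ≤ 1 → ∀ G : ℝ, 0 ≤ G → ∀ h : Esp d → ℂ,
      ContDiff ℝ (⊤ : ℕ∞) h →
      (∀ α β : Fin d → ℕ,
          eLpNorm (fun x => ((∏ i, x i ^ α i : ℝ) : ℂ) * mderiv β h x) 2 volume ≤
            ENNReal.ofReal
              ((C ^ (1 + (∑ i, α i) + ∑ i, β i) /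
                  t ^ (r₁ * (((∑ i, α i : ℕ) : ℝ) + ((∑ i, β i : ℕ) : ℝ)) + r₂)) *
                (∏ i, ((α i).factorial : ℝ)) ^ ν * (∏ i, ((β i).factorial : ℝ)) ^ μ * G)) →
      ∀ N : ℕ, 1 ≤ N →
        eLpNorm (fun z => (ρ z / (1 - L)) ^ N * Wd N h z) 2 volume ≤
          ENNReal.ofReal (K ^ N / t ^ (2 * r₁ * N + r₂) * (N.factorial : ℝ) ^ (μ + δ * ν) * G) := by
  have hL' : 0 < 1 - L := by linarith
  set R1 := max (R / (1 - L)) 1 with hR1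
  have hR11 : 1 ≤ R1 := le_max_right _ _
  have hd' : (1:ℝ) ≤ d := by exact_mod_cast hd
  set D : ℝ := d + 1 with hD
  have hD1 : 1 ≤ D := by linarith
  have hj1 : ∀ z : Esp d, 1 ≤ jap z := by
    intro z
    unfold jap
    apply Real.one_le_sqrt.2
    have := sq_nonneg ‖z‖
    linarith
  refine ⟨D ^ 3 * R1 * C ^ 3 * Real.exp (ν + δ * ν), ?_, ?_⟩
  · have h1 : 1 ≤ D ^ 3 := one_le_pow₀ hD1
    have h2 : 1 ≤ C ^ 3 := one_le_pow₀ hC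
    have h3 : 1 ≤ Real.exp (ν + δ * ν) := Real.one_le_exp (by positivity)
    exact one_le_mul_of_one_le_of_one_le (one_le_mul_of_one_le_of_one_le
      (one_le_mul_of_one_le_of_one_le h1 hR11) h2) h3
  intro t ht0 ht1 G hG h hh hest N hN
  set p := ⌈δ * N⌉₊ with hp
  have hN' : (1:ℝ) ≤ N := by exact_mod_cast hN
  have hpN : p ≤ N := by
    rw [hp]; apply Nat.ceil_le.2
    nlinarith
  have hp1 : (p:ℝ) ≤ δ * N + 1 := (Nat.ceil_lt_add_one (by positivity)).le
  have hp0 : δ * N ≤ p := Nat.le_ceil _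
  -- the common bound
  set Q : ℝ := C ^ (1 + 2 * N) / t ^ (2 * r₁ * N + r₂) * (p.factorial : ℝ) ^ ν *
    (N.factorial : ℝ) ^ μ * G with hQ
  have hest2 : ∀ α β : Fin d → ℕ, ∑ i, β i = N → ∑ i, α i ≤ p →
      (∏ i, ((α i).factorial : ℝ)) ≤ p.factorial →
      eLpNorm (fun x => ((∏ i, x i ^ α i : ℝ) : ℂ) * mderiv β h x) 2 volume ≤ ENNReal.ofReal Q := by
    intro α β hβ hα hα2
    refine (hest α β).trans (ENNReal.ofReal_le_ofReal ?_)
    rw [hQ]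
    have hβf : (∏ i, ((β i).factorial : ℝ)) ≤ N.factorial := by
      rw [← hβ]
      have := Nat.le_of_dvd (Nat.factorial_pos _)
        (Nat.prod_factorial_dvd_factorial_sum (Finset.univ : Finset (Fin d)) β)
      exact_mod_cast this
    have hαN : ((∑ i, α i : ℕ) : ℝ) ≤ N := by exact_mod_cast hα.trans hpN
    have hprod : ∀ α : Fin d → ℕ, (0:ℝ) ≤ ∏ i, ((α i).factorial : ℝ) := fun α =>
      Finset.prod_nonneg fun _ _ => by positivity
    have h1 := hprod α
    have h2 := hprod β
    have htp : t ^ (2 * r₁ * N + r₂) ≤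
        t ^ (r₁ * (((∑ i, α i : ℕ) : ℝ) + ((∑ i, β i : ℕ) : ℝ)) + r₂) := by
      apply Real.rpow_le_rpow_of_exponent_ge ht0 ht1
      rw [hβ]
      nlinarith
    have hCp : C ^ (1 + (∑ i, α i) + ∑ i, β i) ≤ C ^ (1 + 2 * N) := by
      apply pow_le_pow_right₀ hC
      rw [hβ]; omega
    gcongr
  have hrho : ∀ z : Esp d, (ρ z / (1 - L)) ^ N ≤ R1 ^ N * jap z ^ p := by
    intro z
    have h1 : ρ z / (1 - L) ≤ R1 * jap z ^ δ := by
      calc ρ z / (1 - L) ≤ (R * jap z ^ δ) / (1 - L) := by gcongr; exact hρub z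
        _ = R / (1 - L) * jap z ^ δ := by ring
        _ ≤ _ := by
          have : 0 ≤ jap z ^ δ := Real.rpow_nonneg (by linarith [hj1 z]) _
          gcongr
          exact le_max_left _ _
    have h0 : 0 ≤ ρ z / (1 - L) := by have := hρpos z; positivity
    calc (ρ z / (1 - L)) ^ N ≤ (R1 * jap z ^ δ) ^ N := by gcongr
      _ = R1 ^ N * jap z ^ (δ * N) := by
        rw [mul_pow, ← Real.rpow_natCast (jap z ^ δ), ← Real.rpow_mul (by linarith [hj1 z])]
      _ ≤ R1 ^ N * jap z ^ (p:ℝ) := by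
        gcongr
        exact hj1 z
      _ = _ := by rw [Real.rpow_natCast]
  have hW := Wd_Lp (fun z => (ρ z / (1 - L)) ^ N) (by fun_prop) h hh
    (ENNReal.ofReal (R1 ^ N) * (((d:ℝ≥0∞) + 1) ^ (p+1) * ENNReal.ofReal Q)) N 0 (by
      intro β hβ
      simp only [Pi.zero_apply, Finset.sum_const_zero, zero_add] at hβ
      refine le_trans (eLpNorm_le_mul_eLpNorm_of_ae_le_mul
        (g := fun z => jap z ^ p * ‖mderiv β h z‖) (c := R1 ^ N) (ae_of_all _ fun z => ?_) 2) ?_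
      · have h0 : 0 ≤ ρ z / (1 - L) := by have := hρpos z; positivity
        have h1 := hj1 z
        rw [Real.norm_eq_abs, Real.norm_eq_abs, abs_of_nonneg (by positivity),
          abs_of_nonneg (by positivity), ← mul_assoc]
        gcongr
        exact hrho z
      · gcongr
        refine weight_Lp hd _ (mderiv_smooth β h hh).continuous p _ ?_ fun i => ?_
        · have := hest2 0 β hβ (by simp) (by simp; exact_mod_cast Nat.factorial_pos p)
          simpa using this
        · have := hest2 (Pi.single i p) β hβ (by simp) (by
            rw [Finset.prod_eq_single i]
            · simp
            · intro j _ hj; simp [hj]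
            · simp)
          refine le_trans (le_of_eq ?_) this
          congr 1
          funext z
          rw [Finset.prod_eq_single i]
          · simp
          · intro j _ hj; simp [hj]
          · simp)
  rw [mderiv_zero] at hW
  refine hW.trans ?_
  have hdD : ((d:ℝ≥0∞) + 1) = ENNReal.ofReal D := by
    rw [hD, ENNReal.ofReal_add (by positivity) (by positivity)]; simp
  have hdd : (d:ℝ≥0∞) = ENNReal.ofReal d := by simp
  have hQ0 : 0 ≤ Q := by positivity
  rw [hdD, hdd, ← ENNReal.ofReal_pow (by positivity), ← ENNReal.ofReal_pow (by positivity),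
    ← ENNReal.ofReal_mul (by positivity), ← ENNReal.ofReal_mul (by positivity),
    ← ENNReal.ofReal_mul (by positivity)]
  apply ENNReal.ofReal_le_ofReal
  have hfb := fact_bound δ ν hδ0 hν N p hN hpN hp1
  have e1 : (d:ℝ) ^ N ≤ D ^ N := by gcongr; linarith
  have e2 : D ^ (p+1) ≤ D ^ (2 * N) := pow_le_pow_right₀ hD1 (by omega)
  have e3 : C ^ (1 + 2 * N) ≤ C ^ (3 * N) := pow_le_pow_right₀ hC (by omega)
  calc (d:ℝ) ^ N * (R1 ^ N * (D ^ (p+1) * Q))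
      ≤ D ^ N * (R1 ^ N * (D ^ (2 * N) * (C ^ (3 * N) / t ^ (2 * r₁ * N + r₂) *
        ((Real.exp (ν + δ * ν)) ^ N * (N.factorial : ℝ) ^ (δ * ν)) *
          (N.factorial : ℝ) ^ μ * G))) := by
        rw [hQ]
        gcongr
    _ = _ := by
        rw [Real.rpow_add (x := (N.factorial:ℝ)) (by positivity) μ (δ * ν)]
        simp only [mul_pow, ← pow_mul]
        rw [show 3 * N = N + 2 * N by ring, pow_add D]
        ring


lemma lint_sq {E F : Type*} [MeasurableSpace E] [NormedAddCommGroup F] (f : E → F) (m : Measure E) :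
    ∫⁻ z, ‖f z‖ₑ ^ 2 ∂m = eLpNorm f 2 m ^ 2 := by
  have h2 := eLpNorm_nnreal_pow_eq_lintegral (p := 2) (f := f) (μ := m) (by norm_num)
  simp at h2
  exact h2.symm

set_option maxHeartbeats 2000000 in
lemma propA {d : ℕ} (hd : 1 ≤ d) (μ ν : ℝ) (hμ0 : 0 < μ) (hν : 0 < ν)
    (C : ℝ) (hC : 1 ≤ C) (r₁ : ℝ) (hr₁ : 0 < r₁) (r₂ : ℝ)
    (δ : ℝ) (hδ0 : 0 ≤ δ) (hδ1 : δ ≤ 1) (ρ : Esp d → ℝ) (hρpos : ∀ x, 0 < ρ x)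
    (hρcont : Continuous ρ) (L : ℝ) (hL0 : 0 ≤ L) (hL1 : L < 1)
    (hLip : ∀ x y, |ρ x - ρ y| ≤ L * ‖x - y‖)
    (R : ℝ) (hR : 0 < R) (hρub : ∀ x, ρ x ≤ R * jap x ^ δ)
    (ω : Set (Esp d)) (hω : MeasurableSet ω) (γ : ℝ) (hγ0 : 0 < γ) (hγ1 : γ ≤ 1)
    (hthick : ∀ x, ENNReal.ofReal γ * volume (Metric.ball x (ρ x)) ≤
      volume (ω ∩ Metric.ball x (ρ x))) :
    ∃ K : ℝ, 1 ≤ K ∧ ∀ t : ℝ, 0 < t → t ≤ 1 → ∀ G : ℝ, 0 ≤ G → ∀ h : Esp d → ℂ,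
      ∀ φ : Lp ℂ 2 (volume : Measure (Esp d)), (φ : Esp d → ℂ) =ᵐ[volume] h →
      ContDiff ℝ (⊤ : ℕ∞) h →
      (∀ α β : Fin d → ℕ,
          eLpNorm (fun x => ((∏ i, x i ^ α i : ℝ) : ℂ) * mderiv β h x) 2 volume ≤
            ENNReal.ofReal
              ((C ^ (1 + (∑ i, α i) + ∑ i, β i) /
                  t ^ (r₁ * (((∑ i, α i : ℕ) : ℝ) + ((∑ i, β i : ℕ) : ℝ)) + r₂)) *
                (∏ i, ((α i).factorial : ℝ)) ^ ν * (∏ i, ((β i).factorial : ℝ)) ^ μ * G)) →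
      ∀ N : ℕ, 1 ≤ N →
        ‖φ‖ ^ 2 ≤ K ^ N * ((eLpNorm (φ : Esp d → ℂ) 2 (volume.restrict ω)).toReal) ^ 2 +
          K ^ N * (1 / t ^ (2 * r₁ * N + r₂) * (N.factorial : ℝ) ^ (μ + δ * ν - 1) * G) ^ 2 := by
  obtain ⟨K1, hK1, hE⟩ := deriv_est hd μ ν hμ0 hν C hC r₁ hr₁ r₂ δ hδ0 hδ1 ρ hρpos hρcont L hL1
    R hR hρub
  have hL' : 0 < 1 - L := by linarith
  have hd' : (1:ℝ) ≤ d := by exact_mod_cast hd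
  set c : ℝ := (γ/2)^2 / (8 * d) with hc
  have hc0 : 0 < c := by rw [hc]; positivity
  have hc1 : c ≤ 1 := by
    rw [hc, div_le_one (by positivity)]; nlinarith
  set A : ℝ := ((1 + L) / (1 - L)) ^ d with hA
  have hA0 : 0 ≤ A := by positivity
  have h12 : 1 ≤ 12 / c := by rw [le_div_iff₀ hc0]; linarith
  set B : ℝ := 1 + 4 * A / γ + 2 * A / c with hB
  have hB1 : 1 ≤ B := by
    have : 0 ≤ 4 * A / γ := by positivity
    have : 0 ≤ 2 * A / c := by positivity
    linarith
  have hBγ : 4 * A / γ ≤ B := by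
    have : 0 ≤ 2 * A / c := by positivity
    linarith
  have hBc : 2 * A / c ≤ B := by
    have : 0 ≤ 4 * A / γ := by positivity
    linarith
  have he1 : 1 ≤ Real.exp 2 := Real.one_le_exp (by norm_num)
  have hq1 : 1 ≤ (12 / c) ^ 2 := one_le_pow₀ h12
  have hk1 : 1 ≤ K1 ^ 2 := one_le_pow₀ hK1
  have hKK : 1 ≤ Real.exp 2 * K1 ^ 2 := one_le_mul_of_one_le_of_one_le he1 hk1
  refine ⟨(12 / c) ^ 2 * B * (Real.exp 2 * K1 ^ 2),
    one_le_mul_of_one_le_of_one_le (one_le_mul_of_one_le_of_one_le hq1 hB1) hKK, ?_⟩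
  intro t ht0 ht1 G hG h φ hφ hh hest N hN
  obtain ⟨n, rfl⟩ : ∃ n, N = n + 1 := ⟨N - 1, by omega⟩
  have hE' := hE t ht0 ht1 G hG h hh hest (n+1) hN
  set E : ℝ := K1 ^ (n+1) / t ^ (2 * r₁ * ((n+1 : ℕ):ℝ) + r₂) *
    ((n+1).factorial : ℝ) ^ (μ + δ * ν) * G with hEdef
  have hE0 : 0 ≤ E := by positivity
  set w : Esp d → ℝ := fun z => (ρ z / (1 - L)) ^ (n+1) * Wd (n+1) h z with hw
  have hwc : Continuous w := by
    have := Wd_continuous (n+1) h hh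
    fun_prop
  have hglob := global_bound hd ρ hρpos L hL0 hL1 hLip hρcont.measurable ω hω γ hγ0 hγ1 hthick h hh n
    (fun z => ‖w z‖ₑ ^ 2) (by have := hwc.measurable; fun_prop) (by
      intro x y hy θ hθ
      have hv : ‖y - x‖ ≤ ρ x := by
        have := Metric.mem_ball.1 hy
        rw [dist_eq_norm] at this
        exact this.le
      have h1 := iter_line x (y - x) (ρ x) hv (n+1) h hh θ
      have h2 : ‖x - (x + θ • (y - x))‖ ≤ ρ x := by
        rw [sub_add_cancel_left, norm_neg, norm_smul, Real.norm_eq_abs, abs_of_nonneg hθ.1]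
        calc θ * ‖y - x‖ ≤ 1 * ‖y - x‖ := by gcongr; exact hθ.2
          _ ≤ ρ x := by rw [one_mul]; exact hv
      have h3 : ρ x ≤ ρ (x + θ • (y - x)) / (1 - L) := by
        rw [le_div_iff₀ hL']
        have h4 := (abs_le.1 (hLip x (x + θ • (y - x)))).2
        nlinarith
      have h5 : ‖iteratedDeriv (n+1) (fun s : ℝ => h (x + s • (y - x))) θ‖ ≤
          ‖w (x + θ • (y - x))‖ := by
        refine h1.trans (le_trans ?_ (le_abs_self _))
        rw [hw]
        have := Wd_nonneg (n+1) h (x + θ • (y - x))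
        have := (hρpos x).le
        simp only
        gcongr
      gcongr
      exact enorm_le_iff_norm_le.2 h5) c rfl
  rw [lint_sq, lint_sq, lint_sq] at hglob
  have hX : eLpNorm h 2 volume = ENNReal.ofReal ‖φ‖ := by
    rw [← eLpNorm_congr_ae hφ, Lp.norm_def, ENNReal.ofReal_toReal (Lp.eLpNorm_ne_top φ)]
  set Y := (eLpNorm (φ : Esp d → ℂ) 2 (volume.restrict ω)).toReal with hYdef
  have hYtop : eLpNorm (φ : Esp d → ℂ) 2 (volume.restrict ω) ≠ ∞ :=
    ne_top_of_le_ne_top (Lp.eLpNorm_ne_top φ) (eLpNorm_mono_measure _ Measure.restrict_le_self)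
  have hY : eLpNorm h 2 (volume.restrict ω) = ENNReal.ofReal Y := by
    rw [← eLpNorm_congr_ae (ae_restrict_of_ae hφ), hYdef, ENNReal.ofReal_toReal hYtop]
  have hY0 : 0 ≤ Y := ENNReal.toReal_nonneg
  rw [hX, hY] at hglob
  have hglob2 := hglob.trans (mul_le_mul_right (add_le_add le_rfl (mul_le_mul_right
    (mul_le_mul_right (pow_le_pow_left' hE' 2) _) _)) _)
  rw [← ENNReal.ofReal_pow (norm_nonneg _), ← ENNReal.ofReal_pow hY0, ← ENNReal.ofReal_pow hE0,
    ← ENNReal.ofReal_mul hA0, ← ENNReal.ofReal_mul hA0, ← ENNReal.ofReal_mul (by positivity),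
    ← ENNReal.ofReal_mul (by positivity), ← ENNReal.ofReal_add (by positivity) (by positivity),
    ← ENNReal.ofReal_mul (by positivity),
    ENNReal.ofReal_le_ofReal_iff (by positivity)] at hglob2
  refine hglob2.trans ?_
  set e := 2 * r₁ * ((n+1 : ℕ):ℝ) + r₂ with he
  have hBN : B ≤ B ^ (n+1) := le_self_pow₀ hB1 (by omega)
  have hn1 : ((n+1 : ℕ):ℝ) ≤ Real.exp ((n+1 : ℕ):ℝ) := by
    have := Real.add_one_le_exp ((n+1 : ℕ):ℝ); linarith
  have hfac : 1 / (n.factorial : ℝ) ≤ Real.exp ((n+1 : ℕ):ℝ) / ((n+1).factorial : ℝ) := by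
    rw [Nat.factorial_succ, div_le_div_iff₀ (by positivity) (by positivity)]
    push_cast at hn1 ⊢
    nlinarith [show (0:ℝ) < n.factorial by positivity]
  have hEn : 1 / (n.factorial : ℝ) * E ≤ Real.exp ((n+1 : ℕ):ℝ) * K1 ^ (n+1) *
      (1 / t ^ e * ((n+1).factorial : ℝ) ^ (μ + δ * ν - 1) * G) := by
    calc 1 / (n.factorial : ℝ) * E ≤ Real.exp ((n+1 : ℕ):ℝ) / ((n+1).factorial : ℝ) * E := by gcongr
      _ = _ := by
        rw [Real.rpow_sub_one (by positivity), hEdef]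
        ring
  set Z := (1 / t ^ e * ((n+1).factorial : ℝ) ^ (μ + δ * ν - 1) * G) with hZ
  have hZ0 : 0 ≤ Z := by positivity
  have hexp : Real.exp ((n+1 : ℕ):ℝ) ^ 2 = Real.exp 2 ^ (n+1) := by
    rw [← Real.exp_nat_mul, ← Real.exp_nat_mul]
    push_cast; ring_nf
  have hkk : 1 ≤ (Real.exp 2 * K1 ^ 2) ^ (n+1) := one_le_pow₀ hKK
  have t1 : 2 * (12 / c) ^ (2 * (n+1)) * (2 / γ * (A * Y ^ 2)) ≤
      ((12 / c) ^ 2 * B * (Real.exp 2 * K1 ^ 2)) ^ (n+1) * Y ^ 2 := by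
    calc _ = ((12 / c) ^ 2) ^ (n+1) * (4 * A / γ) * 1 * Y ^ 2 := by rw [← pow_mul]; ring
      _ ≤ ((12 / c) ^ 2) ^ (n+1) * B ^ (n+1) * (Real.exp 2 * K1 ^ 2) ^ (n+1) * Y ^ 2 := by
        gcongr
        exact hBγ.trans hBN
      _ = _ := by rw [mul_pow _ (Real.exp 2 * K1 ^ 2), mul_pow _ B]
  have t2 : 2 * (12 / c) ^ (2 * (n+1)) * ((1 / (n.factorial : ℝ)) ^ 2 / c * (A * E ^ 2)) ≤
      ((12 / c) ^ 2 * B * (Real.exp 2 * K1 ^ 2)) ^ (n+1) * Z ^ 2 := by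
    calc _ = ((12 / c) ^ 2) ^ (n+1) * (2 * A / c) * (1 / (n.factorial : ℝ) * E) ^ 2 := by
          rw [← pow_mul]; ring
      _ ≤ ((12 / c) ^ 2) ^ (n+1) * B ^ (n+1) * (Real.exp ((n+1 : ℕ):ℝ) * K1 ^ (n+1) * Z) ^ 2 := by
        gcongr
        exact hBc.trans hBN
      _ = ((12 / c) ^ 2) ^ (n+1) * B ^ (n+1) * ((Real.exp ((n+1 : ℕ):ℝ)) ^ 2 * (K1 ^ 2) ^ (n+1)) *
          Z ^ 2 := by
        rw [← pow_mul K1, mul_comm 2 (n+1), pow_mul K1]; ring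
      _ = _ := by
        rw [hexp, mul_pow _ (Real.exp 2 * K1 ^ 2), mul_pow _ B, mul_pow (Real.exp 2)]
  rw [mul_add]
  exact add_le_add t1 t2


lemma propB_num (K : ℝ) (hK : 1 ≤ K) (σ : ℝ) (hσ : 0 < σ) (r₁ : ℝ) (hr₁ : 0 < r₁) (r₂ : ℝ)
    (hr₂ : 0 ≤ r₂) (κ : ℝ) (hκ : 0 ≤ κ) :
    ∃ M : ℝ, 0 < M ∧ ∀ t : ℝ, 0 < t → t ≤ 1 → ∀ N : ℕ, 1 ≤ N → M * t ^ (-(2 * r₁ / σ)) ≤ N →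
      K ^ N * (1 / t ^ (2 * r₁ * N + r₂) * (N.factorial : ℝ) ^ (-σ)) ^ 2 ≤ Real.exp (-(κ * N)) := by
  have hlK : 0 ≤ Real.log K := Real.log_nonneg hK
  set b : ℝ := σ * r₂ / r₁ with hb
  have hb0 : 0 ≤ b := by positivity
  set m : ℝ := (Real.log K + 2 * σ + b + κ) / (2 * σ) with hm
  have hm0 : 0 ≤ m := by positivity
  have hm2 : 2 * σ * m = Real.log K + 2 * σ + b + κ := by rw [hm]; field_simp
  refine ⟨Real.exp m, Real.exp_pos _, ?_⟩
  intro t ht0 ht1 N hN hMN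
  have hN' : (1:ℝ) ≤ N := by exact_mod_cast hN
  have hN0 : (0:ℝ) < N := by linarith
  set l : ℝ := -Real.log t with hl
  have hl0 : 0 ≤ l := by have := Real.log_nonpos ht0.le ht1; linarith
  have h1 : m + 2 * r₁ / σ * l ≤ Real.log N := by
    have := Real.log_le_log (by positivity) hMN
    rw [Real.log_mul (Real.exp_pos _).ne' (by positivity), Real.log_exp, Real.log_rpow ht0] at this
    rw [hl]; linarith
  have h2 : 2 * r₁ * l ≤ σ * (Real.log N - m) := by
    have h3 : 2 * r₁ / σ * l ≤ Real.log N - m := by linarith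
    calc 2 * r₁ * l = σ * (2 * r₁ / σ * l) := by field_simp
      _ ≤ _ := by gcongr
  have hlogN : Real.log N ≤ N := (Real.log_le_sub_one_of_pos hN0).trans (by linarith)
  have h4 : 2 * r₂ * l ≤ b * N := by
    calc 2 * r₂ * l = r₂ / r₁ * (2 * r₁ * l) := by field_simp
      _ ≤ r₂ / r₁ * (σ * (Real.log N - m)) := by gcongr
      _ ≤ r₂ / r₁ * (σ * N) := by gcongr; linarith
      _ = b * N := by rw [hb]; ring
  have hfac : N * Real.log N - N ≤ Real.log N.factorial := by
    have h5 := Real.pow_div_factorial_le_exp (N:ℝ) (by positivity) N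
    rw [div_le_iff₀ (by positivity)] at h5
    have h6 := Real.log_le_log (by positivity) h5
    rw [Real.log_mul (Real.exp_pos _).ne' (by positivity), Real.log_exp, Real.log_pow] at h6
    linarith
  have hKe : K ^ N = Real.exp (N * Real.log K) := by
    rw [Real.exp_nat_mul, Real.exp_log (by linarith)]
  have hte : 1 / t ^ (2 * r₁ * N + r₂) = Real.exp (l * (2 * r₁ * N + r₂)) := by
    rw [Real.rpow_def_of_pos ht0, one_div, ← Real.exp_neg, hl]; ring_nf
  have hfe : (N.factorial : ℝ) ^ (-σ) = Real.exp (-(σ * Real.log N.factorial)) := by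
    rw [Real.rpow_def_of_pos (by positivity)]; ring_nf
  rw [hKe, hte, hfe, ← Real.exp_add, ← Real.exp_nat_mul, ← Real.exp_add]
  apply Real.exp_le_exp.2
  push_cast
  have h7 : 2 * (N * (2 * r₁ * l)) ≤ 2 * (N * (σ * (Real.log N - m))) := by gcongr
  have h8 : 2 * σ * (N * Real.log N - N) ≤ 2 * σ * Real.log N.factorial := by gcongr
  have h9 : (N:ℝ) * (2 * σ * m) = N * (Real.log K + 2 * σ + b + κ) := by rw [hm2]
  nlinarith

lemma tele_step (X Y : ℝ → ℝ) (hX : AntitoneOn X (Set.Ici 0)) (hX0 : ∀ t, 0 ≤ t → 0 ≤ X t)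
    (hY0 : ∀ t, 0 ≤ Y t) (hYc : ContinuousOn Y (Set.Ici 0)) (K : ℝ) (hK : 1 ≤ K) (a : ℝ)
    (ha : 0 < a) (M : ℝ) (hM : 0 < M) (t₀ : ℝ)
    (hobs : ∀ τ, 0 < τ → τ ≤ t₀ → ∀ s, 0 ≤ s → ∀ N : ℕ, 1 ≤ N → M * τ ^ (-a) ≤ N →
      X (s + τ) ≤ K ^ N * Y (s + τ) + Real.exp (-(((2:ℝ) ^ a * Real.log K + 1) * N)) * X s)
    (T : ℝ) (hT : 0 < T) (hT0 : T ≤ t₀) :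
    (T / 4) * (K ^ ⌈M * (T / 4) ^ (-a)⌉₊)⁻¹ * X T ≤ (∫ t in (T/2)..T, Y t) +
      (T / 2 / 4) * (K ^ ⌈M * (T / 2 / 4) ^ (-a)⌉₊)⁻¹ * X (T / 2) := by
  have hlK : 0 ≤ Real.log K := Real.log_nonneg hK
  set N := ⌈M * (T / 4) ^ (-a)⌉₊ with hN
  set N' := ⌈M * (T / 2 / 4) ^ (-a)⌉₊ with hN'
  set κ : ℝ := (2:ℝ) ^ a * Real.log K + 1 with hκ
  have hN1 : 1 ≤ N := Nat.one_le_ceil_iff.2 (by positivity)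
  have hN1' : (1:ℝ) ≤ N := by exact_mod_cast hN1
  have hNle : M * (T / 4) ^ (-a) ≤ N := Nat.le_ceil _
  have hNN : (N':ℝ) ≤ 2 ^ a * N + 1 := by
    have h1 : (N':ℝ) ≤ M * (T / 2 / 4) ^ (-a) + 1 := (Nat.ceil_lt_add_one (by positivity)).le
    have h2 : (T / 2 / 4) ^ (-a) = 2 ^ a * (T / 4) ^ (-a) := by
      rw [show T / 2 / 4 = (2:ℝ)⁻¹ * (T / 4) by ring, Real.mul_rpow (by norm_num) (by positivity),
        Real.inv_rpow (by norm_num), Real.rpow_neg (by norm_num), inv_inv]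
    rw [h2] at h1
    have h3 : (2:ℝ) ^ a * (M * (T / 4) ^ (-a)) ≤ 2 ^ a * N := by gcongr
    linarith
  have hKpos : 0 < K := by linarith
  have hKe : ∀ n : ℕ, K ^ n = Real.exp (n * Real.log K) := by
    intro n; rw [Real.exp_nat_mul, Real.exp_log hKpos]
  have hw : (T / 4) * (K ^ N)⁻¹ * Real.exp (-(κ * N)) ≤ (T / 2 / 4) * (K ^ N')⁻¹ := by
    have h1 : 2 * ((K ^ N)⁻¹ * Real.exp (-(κ * N))) ≤ (K ^ N')⁻¹ := by
      rw [hKe, hKe, ← Real.exp_neg, ← Real.exp_neg, ← Real.exp_add]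
      have h2 : (2:ℝ) ≤ Real.exp 1 := by
        have := Real.add_one_le_exp (1:ℝ); linarith
      calc _ ≤ Real.exp 1 * Real.exp (-(N * Real.log K) + -(κ * N)) := by gcongr
        _ = Real.exp (1 + (-(N * Real.log K) + -(κ * N))) := by rw [← Real.exp_add]
        _ ≤ _ := by
          apply Real.exp_le_exp.2
          have h3 : (N':ℝ) * Real.log K ≤ (2 ^ a * N + 1) * Real.log K := by gcongr
          rw [hκ]
          nlinarith
    calc (T / 4) * (K ^ N)⁻¹ * Real.exp (-(κ * N))
        = (T / 2 / 4) * (2 * ((K ^ N)⁻¹ * Real.exp (-(κ * N)))) := by ring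
      _ ≤ _ := by gcongr
  have hpt : ∀ t ∈ Set.Icc (3 * T / 4) T, X T - Real.exp (-(κ * N)) * X (T / 2) ≤ K ^ N * Y t := by
    intro t ht
    have hτ0 : T / 4 ≤ t - T / 2 := by linarith [ht.1]
    have h1 := hobs (t - T / 2) (by linarith) (by linarith [ht.2]) (T / 2) (by linarith) N hN1 (by
      refine le_trans ?_ hNle
      refine mul_le_mul_of_nonneg_left ?_ hM.le
      exact Real.rpow_le_rpow_of_nonpos (show 0 < T / 4 by linarith) hτ0 (show -a ≤ 0 by linarith))
    rw [add_sub_cancel] at h1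
    have h2 : X T ≤ X t := hX (Set.mem_Ici.2 (by linarith)) (Set.mem_Ici.2 hT.le) ht.2
    linarith
  have hYI : ∀ p q, 0 ≤ p → 0 ≤ q → IntervalIntegrable Y volume p q := by
    intro p q hp hq
    apply ContinuousOn.intervalIntegrable
    exact hYc.mono fun x hx => le_trans (le_min hp hq) hx.1
  have integI : (T / 4) * (X T - Real.exp (-(κ * N)) * X (T / 2)) ≤
      K ^ N * ∫ t in (3 * T / 4)..T, Y t := by
    have h1 := intervalIntegral.integral_mono_on (μ := volume) (a := 3 * T / 4) (b := T)
      (f := fun _ => X T - Real.exp (-(κ * N)) * X (T / 2)) (g := fun t => K ^ N * Y t)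
      (by linarith) (by simp) ((hYI _ _ (by linarith) hT.le).const_mul _) hpt
    rw [intervalIntegral.integral_const, intervalIntegral.integral_const_mul, smul_eq_mul] at h1
    refine le_trans (le_of_eq ?_) h1
    ring
  have hsub : ∫ t in (3 * T / 4)..T, Y t ≤ ∫ t in (T/2)..T, Y t := by
    rw [← intervalIntegral.integral_add_adjacent_intervals (hYI (T/2) (3*T/4) (by linarith)
      (by linarith)) (hYI (3*T/4) T (by linarith) (by linarith))]
    have : 0 ≤ ∫ t in (T/2)..(3*T/4), Y t :=
      intervalIntegral.integral_nonneg (by linarith) fun t _ => hY0 t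
    linarith
  have hKN : 0 < K ^ N := by positivity
  have integI2 : (K ^ N)⁻¹ * ((T / 4) * (X T - Real.exp (-(κ * N)) * X (T / 2))) ≤
      ∫ t in (T/2)..T, Y t := by
    rw [inv_mul_le_iff₀ hKN]
    exact integI.trans (by gcongr)
  have hfin := mul_le_mul_of_nonneg_right hw (hX0 (T/2) (by linarith))
  nlinarith

lemma tele (X Y : ℝ → ℝ) (hX : AntitoneOn X (Set.Ici 0)) (hX0 : ∀ t, 0 ≤ t → 0 ≤ X t)
    (hY0 : ∀ t, 0 ≤ Y t) (hYc : ContinuousOn Y (Set.Ici 0)) (K : ℝ) (hK : 1 ≤ K) (a : ℝ)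
    (ha : 0 < a) (M : ℝ) (hM : 0 < M) (t₀ : ℝ)
    (hobs : ∀ τ, 0 < τ → τ ≤ t₀ → ∀ s, 0 ≤ s → ∀ N : ℕ, 1 ≤ N → M * τ ^ (-a) ≤ N →
      X (s + τ) ≤ K ^ N * Y (s + τ) + Real.exp (-(((2:ℝ) ^ a * Real.log K + 1) * N)) * X s)
    (T : ℝ) (hT : 0 < T) (hT0 : T ≤ t₀) :
    (T / 4) * (K ^ ⌈M * (T / 4) ^ (-a)⌉₊)⁻¹ * X T ≤ ∫ t in (0:ℝ)..T, Y t := by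
  have hYI : ∀ p q, 0 ≤ p → 0 ≤ q → IntervalIntegrable Y volume p q := by
    intro p q hp hq
    apply ContinuousOn.intervalIntegrable
    exact hYc.mono fun x hx => le_trans (le_min hp hq) hx.1
  have hiter : ∀ J : ℕ, (T / 4) * (K ^ ⌈M * (T / 4) ^ (-a)⌉₊)⁻¹ * X T ≤
      (∫ t in (T / 2 ^ J)..T, Y t) +
      (T / 2 ^ J / 4) * (K ^ ⌈M * (T / 2 ^ J / 4) ^ (-a)⌉₊)⁻¹ * X (T / 2 ^ J) := by
    intro J
    induction J with
    | zero => simp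
    | succ J ih =>
      have hle : T / 2 ^ J ≤ T := div_le_self hT.le (one_le_pow₀ (by norm_num))
      have h1 := tele_step X Y hX hX0 hY0 hYc K hK a ha M hM t₀ hobs (T / 2 ^ J) (by positivity)
        (hle.trans hT0)
      have h2 : T / 2 ^ J / 2 = T / 2 ^ (J+1) := by rw [pow_succ]; field_simp
      rw [h2] at h1
      rw [← intervalIntegral.integral_add_adjacent_intervals (hYI (T / 2 ^ (J+1)) (T / 2 ^ J)
        (by positivity) (by positivity)) (hYI (T / 2 ^ J) T (by positivity) hT.le)]
      linarith
  have hbd : ∀ J : ℕ, (T / 4) * (K ^ ⌈M * (T / 4) ^ (-a)⌉₊)⁻¹ * X T ≤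
      (∫ t in (0:ℝ)..T, Y t) + (T / 4 * X 0) * (1 / 2) ^ J := by
    intro J
    refine (hiter J).trans (add_le_add ?_ ?_)
    · rw [← intervalIntegral.integral_add_adjacent_intervals (hYI 0 (T / 2 ^ J) le_rfl
        (by positivity)) (hYI (T / 2 ^ J) T (by positivity) hT.le)]
      have : 0 ≤ ∫ t in (0:ℝ)..(T / 2 ^ J), Y t :=
        intervalIntegral.integral_nonneg (by positivity) fun t _ => hY0 t
      linarith
    · have h1 : X (T / 2 ^ J) ≤ X 0 :=
        hX (Set.mem_Ici.2 le_rfl) (Set.mem_Ici.2 (by positivity)) (by positivity)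
      have h2 : 0 ≤ X (T / 2 ^ J) := hX0 _ (by positivity)
      have h3 : (K ^ ⌈M * (T / 2 ^ J / 4) ^ (-a)⌉₊)⁻¹ ≤ 1 := inv_le_one_of_one_le₀ (one_le_pow₀ hK)
      calc _ ≤ (T / 2 ^ J / 4) * 1 * X 0 := by gcongr
        _ = _ := by rw [div_pow, one_pow]; ring
  have hlim : Tendsto (fun J : ℕ => (∫ t in (0:ℝ)..T, Y t) + (T / 4 * X 0) * (1 / 2) ^ J) atTop
      (nhds ((∫ t in (0:ℝ)..T, Y t) + (T / 4 * X 0) * 0)) :=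
    ((tendsto_pow_atTop_nhds_zero_of_lt_one (by norm_num) (by norm_num)).const_mul _).const_add _
  rw [mul_zero, add_zero] at hlim
  exact ge_of_tendsto' hlim hbd

lemma tele_final (X Y : ℝ → ℝ) (hX : AntitoneOn X (Set.Ici 0)) (hX0 : ∀ t, 0 ≤ t → 0 ≤ X t)
    (hY0 : ∀ t, 0 ≤ Y t) (hYc : ContinuousOn Y (Set.Ici 0)) (K : ℝ) (hK : 1 ≤ K) (a : ℝ)
    (ha : 0 < a) (M : ℝ) (hM : 0 < M) (t₀ : ℝ) (ht₀ : 0 < t₀)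
    (hobs : ∀ τ, 0 < τ → τ ≤ t₀ → ∀ s, 0 ≤ s → ∀ N : ℕ, 1 ≤ N → M * τ ^ (-a) ≤ N →
      X (s + τ) ≤ K ^ N * Y (s + τ) + Real.exp (-(((2:ℝ) ^ a * Real.log K + 1) * N)) * X s)
    (K' : ℝ) (hK' : K' = 4 * K + M * Real.log K * 4 ^ a + 1 / a)
    (T : ℝ) (hT : 0 < T) :
    X T ≤ (K' * Real.exp (K' / t₀ ^ a)) * Real.exp ((K' * Real.exp (K' / t₀ ^ a)) / T ^ a) *
      ∫ t in Set.Ioc (0:ℝ) T, Y t := by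
  have hlK : 0 ≤ Real.log K := Real.log_nonneg hK
  have hKpos : 0 < K := by linarith
  have hK'0 : 0 < K' := by rw [hK']; positivity
  have hexp1 : 1 ≤ Real.exp (K' / t₀ ^ a) := Real.one_le_exp (by positivity)
  have hYI : ∀ p q, 0 ≤ p → 0 ≤ q → IntervalIntegrable Y volume p q := by
    intro p q hp hq
    apply ContinuousOn.intervalIntegrable
    exact hYc.mono fun x hx => le_trans (le_min hp hq) hx.1
  have hI0 : ∀ T, 0 < T → 0 ≤ ∫ t in (0:ℝ)..T, Y t := fun T hT =>
    intervalIntegral.integral_nonneg hT.le fun t _ => hY0 t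
  have key : ∀ T, 0 < T → T ≤ t₀ → X T ≤ K' * Real.exp (K' / T ^ a) * ∫ t in (0:ℝ)..T, Y t := by
    intro T hT hT0
    have h1 := tele X Y hX hX0 hY0 hYc K hK a ha M hM t₀ hobs T hT hT0
    set N := ⌈M * (T / 4) ^ (-a)⌉₊ with hN
    have hN2 : (N:ℝ) ≤ M * (4 ^ a / T ^ a) + 1 := by
      refine (Nat.ceil_lt_add_one (by positivity)).le.trans (le_of_eq ?_)
      rw [Real.rpow_neg (by positivity), Real.div_rpow hT.le (by norm_num), inv_div]
    have hKN : 0 < K ^ N := by positivity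
    have h2 : X T ≤ (4 / T) * K ^ N * ∫ t in (0:ℝ)..T, Y t := by
      calc X T = (4 / T) * K ^ N * ((T / 4) * (K ^ N)⁻¹ * X T) := by field_simp
        _ ≤ _ := by gcongr
    have hTa : 0 < T ^ a := by positivity
    have h3 : K ^ N ≤ K * Real.exp (M * Real.log K * 4 ^ a / T ^ a) := by
      calc K ^ N = Real.exp (N * Real.log K) := by rw [Real.exp_nat_mul, Real.exp_log hKpos]
        _ ≤ Real.exp ((M * (4 ^ a / T ^ a) + 1) * Real.log K) := by gcongr
        _ = Real.exp (Real.log K + M * Real.log K * 4 ^ a / T ^ a) := by congr 1; ring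
        _ = _ := by rw [Real.exp_add, Real.exp_log hKpos]
    have h4 : 4 / T ≤ 4 * Real.exp (1 / a / T ^ a) := by
      rw [div_eq_mul_inv]
      gcongr
      rw [← Real.exp_log (inv_pos.2 hT)]
      apply Real.exp_le_exp.2
      have h5 := Real.log_le_sub_one_of_pos (inv_pos.2 hTa)
      rw [← Real.inv_rpow hT.le, Real.log_rpow (inv_pos.2 hT), Real.inv_rpow hT.le] at h5
      rw [div_div, le_div_iff₀ (by positivity), ← mul_assoc, ← le_div_iff₀ hTa, one_div]
      linarith
    refine h2.trans ?_
    refine mul_le_mul_of_nonneg_right ?_ (hI0 T hT)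
    calc 4 / T * K ^ N ≤ (4 * Real.exp (1 / a / T ^ a)) *
          (K * Real.exp (M * Real.log K * 4 ^ a / T ^ a)) := by gcongr
      _ = (4 * K) * Real.exp (1 / a / T ^ a + M * Real.log K * 4 ^ a / T ^ a) := by
        rw [Real.exp_add]; ring
      _ ≤ K' * Real.exp (K' / T ^ a) := by
        have hh1 : 0 ≤ M * Real.log K * 4 ^ a := by positivity
        have hh2 : 0 < 1 / a := by positivity
        gcongr
        · rw [hK']; linarith
        · rw [← add_div]
          gcongr
          rw [hK']; linarith
  rw [← intervalIntegral.integral_of_le hT.le]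
  have hKK : K' ≤ K' * Real.exp (K' / t₀ ^ a) := le_mul_of_one_le_right hK'0.le hexp1
  have hTa : 0 < T ^ a := by positivity
  have hIT := hI0 T hT
  rcases le_total T t₀ with h | h
  · refine (key T hT h).trans ?_
    gcongr
  · have h1 : X T ≤ X t₀ := hX (Set.mem_Ici.2 ht₀.le) (Set.mem_Ici.2 hT.le) h
    have h2 : ∫ t in (0:ℝ)..t₀, Y t ≤ ∫ t in (0:ℝ)..T, Y t := by
      rw [← intervalIntegral.integral_add_adjacent_intervals (hYI 0 t₀ le_rfl ht₀.le)
        (hYI t₀ T ht₀.le hT.le)]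
      have : 0 ≤ ∫ t in t₀..T, Y t := intervalIntegral.integral_nonneg h fun t _ => hY0 t
      linarith
    have h3 : 1 ≤ Real.exp ((K' * Real.exp (K' / t₀ ^ a)) / T ^ a) :=
      Real.one_le_exp (by positivity)
    calc X T ≤ K' * Real.exp (K' / t₀ ^ a) * ∫ t in (0:ℝ)..t₀, Y t :=
          h1.trans (key t₀ ht₀ le_rfl)
      _ ≤ K' * Real.exp (K' / t₀ ^ a) * 1 * ∫ t in (0:ℝ)..T, Y t := by rw [mul_one]; gcongr
      _ ≤ _ := by gcongr

/-- Observability for evolution equations whose adjoint systems enjoy smoothing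
estimates in the Gelfand–Shilov space `S^μ_ν` (Theorem `observability_result`). -/
theorem stmt_7 (d : ℕ) (hd : 1 ≤ d)
    (μ ν : ℝ) (hμ0 : 0 < μ) (hμ1 : μ < 1) (hν : 0 < ν) (hμν : 1 ≤ μ + ν)
    (C : ℝ) (hC : 1 ≤ C) (r₁ : ℝ) (hr₁ : 0 < r₁) (r₂ : ℝ) (hr₂ : 0 ≤ r₂)
    (t₀ : ℝ) (ht₀0 : 0 < t₀) (ht₀1 : t₀ ≤ 1)
    (S : ℝ → Lp ℂ 2 (volume : Measure (Esp d)) →L[ℂ] Lp ℂ 2 (volume : Measure (Esp d)))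
    (hS0 : S 0 = ContinuousLinearMap.id ℂ _)
    (hSadd : ∀ t s : ℝ, 0 ≤ t → 0 ≤ s → S (t + s) = (S t).comp (S s))
    (hScont : ∀ g : Lp ℂ 2 (volume : Measure (Esp d)),
      ContinuousOn (fun t => S t g) (Set.Ici 0))
    (hScontr : ∀ t : ℝ, 0 ≤ t → ∀ g : Lp ℂ 2 (volume : Measure (Esp d)), ‖S t g‖ ≤ ‖g‖)
    (hsmooth : ∀ t : ℝ, 0 < t → t ≤ t₀ → ∀ g : Lp ℂ 2 (volume : Measure (Esp d)),
      ∃ h : Esp d → ℂ, ContDiff ℝ (⊤ : ℕ∞) h ∧ (S t g : Esp d → ℂ) =ᵐ[volume] h ∧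
        ∀ α β : Fin d → ℕ,
          eLpNorm (fun x => ((∏ i, x i ^ α i : ℝ) : ℂ) * mderiv β h x) 2 volume ≤
            ENNReal.ofReal
              ((C ^ (1 + (∑ i, α i) + ∑ i, β i) /
                  t ^ (r₁ * (((∑ i, α i : ℕ) : ℝ) + ((∑ i, β i : ℕ) : ℝ)) + r₂)) *
                (∏ i, ((α i).factorial : ℝ)) ^ ν * (∏ i, ((β i).factorial : ℝ)) ^ μ * ‖g‖))
    (δ : ℝ) (hδ0 : 0 ≤ δ) (hδ : δ < (1 - μ) / ν)
    (ρ : Esp d → ℝ) (hρpos : ∀ x, 0 < ρ x) (hρc : IsContractionMap ρ)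
    (m R : ℝ) (hm : 0 < m) (hR : 0 < R)
    (hρlb : ∀ x, m ≤ ρ x) (hρub : ∀ x, ρ x ≤ R * jap x ^ δ)
    (γ : ℝ) (hγ0 : 0 < γ) (hγ1 : γ ≤ 1)
    (ω : Set (Esp d)) (hω : MeasurableSet ω) (hthick : IsThick γ ρ ω) :
    ∃ K : ℝ, 1 ≤ K ∧
      ∀ g : Lp ℂ 2 (volume : Measure (Esp d)), ∀ T : ℝ, 0 < T →
        ‖S T g‖ ^ 2 ≤
          K * Real.exp (K / T ^ (2 * r₁ / (1 - μ - δ * ν))) *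
            ∫ t in Set.Ioc (0 : ℝ) T,
              ((eLpNorm (S t g : Esp d → ℂ) 2 (volume.restrict ω)).toReal) ^ 2 := by
  obtain ⟨L, hL0, hL1, hLip⟩ := hρc
  have hρcont : Continuous ρ := by
    apply LipschitzWith.continuous (K := ⟨L, hL0⟩)
    apply LipschitzWith.of_dist_le_mul
    intro x y
    rw [Real.dist_eq, dist_eq_norm]
    exact hLip x y
  have hδν : δ * ν < 1 - μ := (lt_div_iff₀ hν).1 hδ
  have hδ1 : δ ≤ 1 := hδ.le.trans ((div_le_one hν).2 (by linarith))
  have hσ : 0 < 1 - μ - δ * ν := by linarith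
  set a : ℝ := 2 * r₁ / (1 - μ - δ * ν) with ha
  have ha0 : 0 < a := by positivity
  obtain ⟨K, hK, hA⟩ := propA hd μ ν hμ0 hν C hC r₁ hr₁ r₂ δ hδ0 hδ1 ρ hρpos hρcont L hL0 hL1
    hLip R hR hρub ω hω γ hγ0 hγ1 hthick
  have hlK : 0 ≤ Real.log K := Real.log_nonneg hK
  obtain ⟨M, hM, hB⟩ := propB_num K hK (1 - μ - δ * ν) hσ r₁ hr₁ r₂ hr₂
    ((2:ℝ) ^ a * Real.log K + 1) (by positivity)
  rw [← ha] at hB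
  set K' : ℝ := 4 * K + M * Real.log K * 4 ^ a + 1 / a with hK'
  have hK'1 : 1 ≤ K' := by
    have h1 : 0 ≤ M * Real.log K * 4 ^ a := by positivity
    have h2 : 0 ≤ 1 / a := by positivity
    linarith
  refine ⟨K' * Real.exp (K' / t₀ ^ a), one_le_mul_of_one_le_of_one_le hK'1
    (Real.one_le_exp (by positivity)), ?_⟩
  intro g T hT
  refine tele_final (fun t => ‖S t g‖ ^ 2)
    (fun t => ((eLpNorm (S t g : Esp d → ℂ) 2 (volume.restrict ω)).toReal) ^ 2)
    ?_ (fun t _ => by positivity) (fun t => by positivity) ?_ K hK a ha0 M hM t₀ ht₀0 ?_ K' hK' T hT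
  · intro t1 h1 t2 h2 h12
    have h1' : 0 ≤ t1 := h1
    have h3 : S t2 g = S (t2 - t1) (S t1 g) := by
      have := hSadd (t2 - t1) t1 (by linarith) h1'
      rw [sub_add_cancel] at this
      rw [this]; rfl
    have h4 := hScontr (t2 - t1) (by linarith) (S t1 g)
    simp only
    rw [h3]
    gcongr
  · have h1 : ∀ f : Lp ℂ 2 (volume : Measure (Esp d)),
        (eLpNorm (f : Esp d → ℂ) 2 (volume.restrict ω)).toReal =
          ‖LpToLpRestrictCLM (Esp d) ℂ ℝ volume 2 ω f‖ := by
      intro f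
      rw [Lp.norm_def, eLpNorm_congr_ae (LpToLpRestrictCLM_coeFn ℝ ω f)]
    simp only [h1]
    exact (((LpToLpRestrictCLM (Esp d) ℂ ℝ volume 2 ω).continuous.comp_continuousOn
      (hScont g)).norm).pow 2
  · intro τ hτ0 hτ1 s hs N hN hMN
    obtain ⟨h, hsm, hae, hest⟩ := hsmooth τ hτ0 hτ1 (S s g)
    have h1 := hA τ hτ0 (hτ1.trans ht₀1) ‖S s g‖ (norm_nonneg _) h (S τ (S s g)) hae hsm hest N hN
    have h2 : S (s + τ) g = S τ (S s g) := by
      rw [add_comm, hSadd τ s hτ0.le hs]; rfl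
    have h3 := hB τ hτ0 (hτ1.trans ht₀1) N hN hMN
    rw [show -(1 - μ - δ * ν) = μ + δ * ν - 1 by ring] at h3
    beta_reduce
    rw [h2]
    refine h1.trans (add_le_add le_rfl ?_)
    rw [mul_pow, ← mul_assoc]
    exact mul_le_mul_of_nonneg_right h3 (by positivity)

end
end

section
/- Let d ≥ 1 and N ∈ ℕ. For every f ∈ E_N = Span_ℂ{Φ_α : α ∈ ℕ^d, |α| ≤ N} and all multi-indices α, β ∈ ℕ^d: ‖x^α ∂_x^β f‖_{L²(ℝ^d)} ≤ 2^{(|α|+|β|)/2} √((N+|α|+|β|)!/N!) ‖f‖_{L²(ℝ^d)}. -/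
open MeasureTheory Filter
open scoped ENNReal NNReal

noncomputable section

/-- The standard one-dimensional Hermite functions. -/
def hermite1 (k : ℕ) (x : ℝ) : ℝ :=
  ((-1 : ℝ) ^ k / Real.sqrt (2 ^ k * k.factorial * Real.sqrt Real.pi)) *
    Real.exp (x ^ 2 / 2) * iteratedDeriv k (fun y => Real.exp (-y ^ 2)) x

/-- The `d`-dimensional Hermite functions `Φ_α`. -/
def hermiteFun {d : ℕ} (α : Fin d → ℕ) (x : Esp d) : ℝ :=
  ∏ j, hermite1 (α j) (x j)

/-- The Hermite coefficient `⟨f, Φ_α⟩_{L²(ℝ^d)}`. -/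
def hermiteCoeff {d : ℕ} (f : Esp d → ℂ) (α : Fin d → ℕ) : ℂ :=
  ∫ x, f x * ((hermiteFun α x : ℝ) : ℂ)

/-- The set of values whose supremum defines `M_p = sup_{t ≥ 0} t^p e^{-Θ(t)}`. -/
def MseqSet (Θ : ℝ → ℝ) (p : ℕ) : Set ℝ :=
  {y : ℝ | ∃ t : ℝ, 0 ≤ t ∧ y = t ^ p * Real.exp (-Θ t)}

/-- The sequence `M_p = sup_{t ≥ 0} t^p e^{-Θ(t)}` associated with `Θ`. -/
def Mseq (Θ : ℝ → ℝ) (p : ℕ) : ℝ := sSup (MseqSet Θ p)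

/-- The square of the norm of the weighted Gelfand–Shilov space `GS_Θ`,
`‖f‖²_{GS_Θ} = ∑_α e^{2Θ(|α|)} |⟨f,Φ_α⟩|²`. -/
def GSThetaNormSq {d : ℕ} (Θ : ℝ → ℝ) (f : Esp d → ℂ) : ℝ≥0∞ :=
  ∑' α : Fin d → ℕ,
    ENNReal.ofReal (Real.exp (2 * Θ ((∑ i, α i : ℕ) : ℝ)) * ‖hermiteCoeff f α‖ ^ 2)

/-- `E_N`: the complex linear span of the Hermite functions `Φ_α` with `|α| ≤ N`. -/
def hermiteSpan (d N : ℕ) : Submodule ℂ (Esp d → ℂ) :=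
  Submodule.span ℂ
    {g : Esp d → ℂ | ∃ α : Fin d → ℕ, (∑ i, α i) ≤ N ∧
      g = fun x => ((hermiteFun α x : ℝ) : ℂ)}

/-! ### One-dimensional Hermite functions -/

def gG (k : ℕ) (x : ℝ) : ℝ := iteratedDeriv k (fun y => Real.exp (-y ^ 2)) x

theorem gG_hasDerivAt (k : ℕ) (x : ℝ) : HasDerivAt (gG k) (gG (k + 1) x) x := by
  have hc : ContDiff ℝ (k + 1 : ℕ) (fun y : ℝ => Real.exp (-y ^ 2)) := by fun_prop
  have h : Differentiable ℝ (gG k) := by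
    unfold gG
    exact hc.differentiable_iteratedDeriv k (by exact_mod_cast Nat.lt_succ_self k)
  have := (h x).hasDerivAt
  have e : gG (k + 1) x = deriv (gG k) x := by
    unfold gG
    rw [iteratedDeriv_succ]
  rw [e]; exact this

theorem gG_zero (x : ℝ) : gG 0 x = Real.exp (-x ^ 2) := by simp [gG]

theorem gG_one (x : ℝ) : gG 1 x = -2 * x * gG 0 x := by
  have h := gG_hasDerivAt 0 x
  have h2 : HasDerivAt (gG 0) (Real.exp (-x ^ 2) * (-(2 * x))) x := by
    have : gG 0 = fun x => Real.exp (-x ^ 2) := funext gG_zero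
    rw [this]
    have := ((hasDerivAt_pow 2 x).neg).exp
    simpa using this
  rw [h.unique h2, gG_zero]; ring

theorem gG_rec (k : ℕ) : ∀ x : ℝ, gG (k + 2) x = -2 * x * gG (k + 1) x - 2 * (k + 1) * gG k x := by
  induction k with
  | zero =>
    intro x
    have h := gG_hasDerivAt 1 x
    have e : gG 1 = fun x => -2 * x * gG 0 x := funext gG_one
    have h2 : HasDerivAt (fun x => -2 * x * gG 0 x) (-2 * 1 * gG 0 x + -2 * x * gG 1 x) x :=
      ((hasDerivAt_id x).const_mul (-2)).mul (gG_hasDerivAt 0 x)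
    rw [← e] at h2
    have := h.unique h2
    simp only [zero_add] at this ⊢
    rw [show (1 + 1 : ℕ) = 2 from rfl] at this
    rw [this]; push_cast; ring
  | succ k ih =>
    intro x
    have h := gG_hasDerivAt (k + 2) x
    have e : gG (k + 2) = fun x => -2 * x * gG (k + 1) x - 2 * (k + 1) * gG k x := funext ih
    have h2 : HasDerivAt (fun x => -2 * x * gG (k + 1) x - 2 * (k + 1) * gG k x)
        ((-2 * 1 * gG (k + 1) x + -2 * x * gG (k + 1 + 1) x) - 2 * (k + 1) * gG (k + 1) x) x :=
      (((hasDerivAt_id x).const_mul (-2)).mul (gG_hasDerivAt (k + 1) x)).sub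
        ((gG_hasDerivAt k x).const_mul _)
    rw [← e] at h2
    have := h.unique h2
    rw [show k + 1 + 2 = k + 2 + 1 from rfl, this]; push_cast; ring

def hC (k : ℕ) : ℝ := (-1 : ℝ) ^ k / Real.sqrt (2 ^ k * k.factorial * Real.sqrt Real.pi)

theorem hC_succ (k : ℕ) : hC k = - Real.sqrt (2 * (k + 1)) * hC (k + 1) := by
  unfold hC
  have e : (2 : ℝ) ^ (k + 1) * (k + 1).factorial * Real.sqrt Real.pi =
      (2 * (k + 1)) * (2 ^ k * k.factorial * Real.sqrt Real.pi) := by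
    rw [Nat.factorial_succ]; push_cast; ring
  have hp : 0 < Real.sqrt Real.pi := Real.sqrt_pos.2 Real.pi_pos
  have h1 : (0 : ℝ) < 2 ^ k * k.factorial * Real.sqrt Real.pi := by
    have : (0 : ℝ) < k.factorial := by exact_mod_cast k.factorial_pos
    positivity
  have h2 : (0 : ℝ) < 2 * (k + 1) := by positivity
  rw [e, Real.sqrt_mul h2.le]
  have := Real.sqrt_pos.2 h1
  have := Real.sqrt_pos.2 h2
  field_simp
  ring

theorem hermite1_eq (k : ℕ) (x : ℝ) :
    hermite1 k x = hC k * Real.exp (x ^ 2 / 2) * gG k x := rfl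

theorem hermite1_deriv0 (k : ℕ) (x : ℝ) :
    HasDerivAt (hermite1 k) (x * hermite1 k x - Real.sqrt (2 * (k + 1)) * hermite1 (k + 1) x) x := by
  have h : HasDerivAt (fun x => hC k * Real.exp (x ^ 2 / 2) * gG k x)
      (hC k * (Real.exp (x ^ 2 / 2) * x) * gG k x + hC k * Real.exp (x ^ 2 / 2) * gG (k + 1) x) x := by
    refine HasDerivAt.mul (HasDerivAt.const_mul _ ?_) (gG_hasDerivAt k x)
    have := ((hasDerivAt_pow 2 x).div_const 2).exp
    simpa using this
  refine HasDerivAt.congr_deriv (f := hermite1 k) h ?_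
  simp only [hermite1_eq]
  rw [show hC k * Real.exp (x ^ 2 / 2) * gG (k + 1) x =
    (- Real.sqrt (2 * (k + 1)) * hC (k + 1)) * Real.exp (x ^ 2 / 2) * gG (k + 1) x by
      rw [← hC_succ]]
  ring

/-- `h_{k}` with the convention that the coefficient vanishes at `k = 0`. -/
theorem hermite1_mul (k : ℕ) (x : ℝ) :
    x * hermite1 k x = Real.sqrt ((k + 1) / 2) * hermite1 (k + 1) x +
      Real.sqrt (k / 2) * hermite1 (k - 1) x := by
  have hs : ∀ t : ℝ, 0 ≤ t → Real.sqrt (2 * t) = 2 * Real.sqrt (t / 2) := by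
    intro t ht
    rw [show 2 * t = 2 ^ 2 * (t / 2) by ring, Real.sqrt_mul (by positivity),
      Real.sqrt_sq (by norm_num)]
  have hq : ∀ t : ℝ, 0 ≤ t → Real.sqrt (t / 2) * Real.sqrt (t / 2) = t / 2 := fun t ht =>
    Real.mul_self_sqrt (by positivity)
  cases k with
  | zero =>
    simp only [hermite1_eq]
    rw [hC_succ 0, zero_add, gG_one]
    simp only [CharP.cast_eq_zero, zero_add, zero_div, Real.sqrt_zero, zero_mul, add_zero]
    rw [hs 1 (by norm_num)]
    ring
  | succ k =>
    simp only [hermite1_eq]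
    rw [show k + 1 - 1 = k from rfl, show k + 1 + 1 = k + 2 from rfl, gG_rec, hC_succ k,
      hC_succ (k + 1)]
    push_cast
    rw [hs (k + 1) (by positivity), hs (k + 1 + 1) (by positivity)]
    have h1 := hq (k + 1) (by positivity)
    linear_combination (-4 * hC (k + 2) * √((k + 1 + 1 : ℝ) / 2) * Real.exp (x ^ 2 / 2) * gG k x) * h1

theorem hermite1_deriv (k : ℕ) (x : ℝ) :
    HasDerivAt (hermite1 k) (Real.sqrt (k / 2) * hermite1 (k - 1) x
      - Real.sqrt ((k + 1) / 2) * hermite1 (k + 1) x) x := by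
  convert hermite1_deriv0 k x using 1
  rw [hermite1_mul]
  have : Real.sqrt (2 * (k + 1)) = 2 * Real.sqrt ((k + 1) / 2) := by
    rw [show (2 * (k + 1) : ℝ) = 2 ^ 2 * ((k + 1) / 2) by ring, Real.sqrt_mul (by positivity),
      Real.sqrt_sq (by norm_num)]
  rw [this]; ring

theorem hermite1_differentiable (k : ℕ) : Differentiable ℝ (hermite1 k) :=
  fun x => (hermite1_deriv k x).differentiableAt

theorem hermite1_continuous (k : ℕ) : Continuous (hermite1 k) :=
  (hermite1_differentiable k).continuous

theorem gG_poly (k : ℕ) : ∃ p : Polynomial ℝ, ∀ x, gG k x = p.eval x * Real.exp (-x ^ 2) := by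
  have : (∃ p : Polynomial ℝ, ∀ x, gG k x = p.eval x * Real.exp (-x ^ 2)) ∧
      ∃ p : Polynomial ℝ, ∀ x, gG (k + 1) x = p.eval x * Real.exp (-x ^ 2) := by
    induction k with
    | zero =>
      refine ⟨⟨1, fun x => by simp [gG_zero]⟩, ⟨-2 * Polynomial.X, fun x => ?_⟩⟩
      rw [zero_add, gG_one, gG_zero]; simp
    | succ k ih =>
      refine ⟨ih.2, ?_⟩
      obtain ⟨⟨p, hp⟩, ⟨q, hq⟩⟩ := ih
      refine ⟨Polynomial.C (-2) * Polynomial.X * q - Polynomial.C (2 * (k + 1) : ℝ) * p, fun x => ?_⟩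
      rw [show k + 1 + 1 = k + 2 from rfl, gG_rec, hp, hq]
      simp only [Polynomial.eval_sub, Polynomial.eval_mul, Polynomial.eval_C, Polynomial.eval_X]
      ring
  exact this.1

theorem hermite1_poly (k : ℕ) :
    ∃ p : Polynomial ℝ, ∀ x, hermite1 k x = p.eval x * Real.exp (-x ^ 2 / 2) := by
  obtain ⟨p, hp⟩ := gG_poly k
  refine ⟨Polynomial.C (hC k) * p, fun x => ?_⟩
  rw [hermite1_eq, hp, Polynomial.eval_mul, Polynomial.eval_C,
    show (-x ^ 2 / 2 : ℝ) = x ^ 2 / 2 + -x ^ 2 by ring, Real.exp_add]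
  ring

theorem integrable_poly_gauss (p : Polynomial ℝ) :
    Integrable (fun x : ℝ => p.eval x * Real.exp (-x ^ 2)) := by
  induction p using Polynomial.induction_on' with
  | add p q hp hq =>
    refine (hp.add hq).congr (Eventually.of_forall fun x => ?_)
    simp [add_mul]
  | monomial n a =>
    have := (integrable_rpow_mul_exp_neg_mul_sq (b := 1) one_pos (s := n)
      (by have : (0:ℝ) ≤ n := n.cast_nonneg
          linarith)).const_mul a
    simpa [mul_assoc] using this

theorem hermite1_integrable (k l : ℕ) : Integrable (fun x => hermite1 k x * hermite1 l x) := by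
  obtain ⟨p, hp⟩ := hermite1_poly k
  obtain ⟨q, hq⟩ := hermite1_poly l
  convert integrable_poly_gauss (p * q) using 2 with x
  rw [hp, hq, Polynomial.eval_mul, show (-x ^ 2 : ℝ) = -x ^ 2 / 2 + -x ^ 2 / 2 by ring,
    Real.exp_add]
  ring

theorem hermite1_ladder (k l : ℕ) :
    Real.sqrt (k / 2) * (∫ x, hermite1 (k - 1) x * hermite1 l x) =
      Real.sqrt ((l + 1) / 2) * ∫ x, hermite1 k x * hermite1 (l + 1) x := by
  have I := hermite1_integrable
  -- derivative of the product has integral zero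
  have hd : ∀ x, HasDerivAt (fun x => hermite1 k x * hermite1 l x)
      ((Real.sqrt (k / 2) * (hermite1 (k - 1) x * hermite1 l x)
      - Real.sqrt ((k + 1) / 2) * (hermite1 (k + 1) x * hermite1 l x)) +
      (Real.sqrt (l / 2) * (hermite1 k x * hermite1 (l - 1) x)
      - Real.sqrt ((l + 1) / 2) * (hermite1 k x * hermite1 (l + 1) x))) x := fun x => by
    refine ((hermite1_deriv k x).mul (hermite1_deriv l x)).congr_deriv ?_
    ring
  have h0 := integral_eq_zero_of_hasDerivAt_of_integrable hd
    ((((I _ _).const_mul _).sub ((I _ _).const_mul _)).add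
      (((I _ _).const_mul _).sub ((I _ _).const_mul _))) (I k l)
  have h1 : (∫ x, (Real.sqrt ((k + 1) / 2) * (hermite1 (k + 1) x * hermite1 l x) +
      Real.sqrt (k / 2) * (hermite1 (k - 1) x * hermite1 l x))) =
      ∫ x, (Real.sqrt ((l + 1) / 2) * (hermite1 k x * hermite1 (l + 1) x) +
      Real.sqrt (l / 2) * (hermite1 k x * hermite1 (l - 1) x)) := by
    congr 1; ext x
    have a := hermite1_mul k x
    have b := hermite1_mul l x
    linear_combination hermite1 k x * b - hermite1 l x * a
  have J : ∀ (a b : ℝ) (k l k' l' : ℕ), Integrable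
      (fun x => a * (hermite1 k x * hermite1 l x) - b * (hermite1 k' x * hermite1 l' x)) :=
    fun a b k l k' l' => ((I _ _).const_mul _).sub ((I _ _).const_mul _)
  rw [integral_add (J _ _ _ _ _ _) (J _ _ _ _ _ _),
    integral_sub ((I _ _).const_mul _) ((I _ _).const_mul _),
    integral_sub ((I _ _).const_mul _) ((I _ _).const_mul _)] at h0
  rw [integral_add ((I _ _).const_mul _) ((I _ _).const_mul _),
    integral_add ((I _ _).const_mul _) ((I _ _).const_mul _)] at h1
  simp only [integral_const_mul] at h0 h1
  linarith

theorem hermite1_norm_zero : ∫ x, hermite1 0 x * hermite1 0 x = 1 := by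
  have h : ∀ x, hermite1 0 x * hermite1 0 x = (Real.sqrt Real.pi)⁻¹ * Real.exp (-1 * x ^ 2) := by
    intro x
    rw [hermite1_eq, gG_zero]
    have : hC 0 * hC 0 = (Real.sqrt Real.pi)⁻¹ := by
      unfold hC
      simp only [pow_zero, Nat.factorial_zero, Nat.cast_one, one_mul]
      rw [← mul_div_mul_comm, Real.mul_self_sqrt (Real.sqrt_nonneg _)]; simp
    rw [← this, show hC 0 * Real.exp (x ^ 2 / 2) * Real.exp (-x ^ 2) *
      (hC 0 * Real.exp (x ^ 2 / 2) * Real.exp (-x ^ 2)) = hC 0 * hC 0 *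
      (Real.exp (x ^ 2 / 2) * Real.exp (-x ^ 2) * Real.exp (x ^ 2 / 2) * Real.exp (-x ^ 2)) by ring,
      ← Real.exp_add, ← Real.exp_add, ← Real.exp_add]
    congr 2; ring
  simp_rw [h]
  rw [integral_const_mul, integral_gaussian, div_one]
  exact inv_mul_cancel₀ (Real.sqrt_pos.2 Real.pi_pos).ne'

theorem hermite1_orthonormal (k l : ℕ) :
    ∫ x, hermite1 k x * hermite1 l x = if k = l then 1 else 0 := by
  have pos : ∀ l : ℕ, (0 : ℝ) < Real.sqrt ((l + 1) / 2) := fun l => Real.sqrt_pos.2 (by positivity)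
  have hz : ∀ l, ∫ x, hermite1 0 x * hermite1 (l + 1) x = 0 := by
    intro l
    have := hermite1_ladder 0 l
    simp only [CharP.cast_eq_zero, zero_div, Real.sqrt_zero, zero_mul] at this
    exact (mul_eq_zero.1 this.symm).resolve_left (pos l).ne'
  induction k generalizing l with
  | zero =>
    cases l with
    | zero => simpa using hermite1_norm_zero
    | succ l => simpa using hz l
  | succ k ih =>
    cases l with
    | zero =>
      rw [if_neg (by simp), ← hz k]
      simp_rw [mul_comm]
    | succ l =>
      have := hermite1_ladder (k + 1) l
      rw [Nat.add_sub_cancel, ih l] at this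
      push_cast at this
      by_cases hkl : k = l
      · subst hkl
        simp only [if_true] at this ⊢
        exact (mul_left_cancel₀ (pos k).ne' this).symm
      · rw [if_neg hkl] at this
        rw [if_neg (by simpa using hkl)]
        rw [mul_zero] at this
        exact (mul_eq_zero.1 this.symm).resolve_left (pos l).ne'

/-! ### Multi-dimensional Hermite functions -/

/-- Complex-valued Hermite function. -/
def PhiC {d : ℕ} (α : Fin d → ℕ) : Esp d → ℂ := fun x => ((hermiteFun α x : ℝ) : ℂ)

theorem hermiteFun_continuous {d : ℕ} (α : Fin d → ℕ) : Continuous (hermiteFun α) := by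
  unfold hermiteFun
  refine continuous_finsetProd _ fun j _ => (hermite1_continuous _).comp ?_
  fun_prop

theorem hermiteFun_integral {d : ℕ} (α β : Fin d → ℕ) :
    ∫ x : Esp d, hermiteFun α x * hermiteFun β x = if α = β then 1 else 0 := by
  have h := (PiLp.volume_preserving_ofLp (Fin d)).integral_comp
    (MeasurableEquiv.toLp 2 (Fin d → ℝ)).symm.measurableEmbedding
    (fun y : Fin d → ℝ => ∏ j, (hermite1 (α j) (y j) * hermite1 (β j) (y j)))
  have h2 := integral_fintype_prod_volume_eq_prod (𝕜 := ℝ)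
    (fun (j : Fin d) (t : ℝ) => hermite1 (α j) t * hermite1 (β j) t)
  rw [h2] at h
  simp only [hermiteFun, ← Finset.prod_mul_distrib]
  refine h.trans ?_
  simp only [hermite1_orthonormal]
  split_ifs with hab
  · subst hab; simp
  · obtain ⟨j, hj⟩ := Function.ne_iff.1 hab
    exact Finset.prod_eq_zero (Finset.mem_univ j) (by simp [hj])

theorem hermiteFun_integrable {d : ℕ} (α β : Fin d → ℕ) :
    Integrable (fun x : Esp d => hermiteFun α x * hermiteFun β x) := by
  have h := ((PiLp.volume_preserving_ofLp (Fin d)).integrable_comp_emb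
    (MeasurableEquiv.toLp 2 (Fin d → ℝ)).symm.measurableEmbedding
    (g := fun y : Fin d → ℝ => ∏ j, (hermite1 (α j) (y j) * hermite1 (β j) (y j)))).2
    (Integrable.fintype_prod (f := fun (j : Fin d) (t : ℝ) => hermite1 (α j) t * hermite1 (β j) t)
      (fun j => hermite1_integrable _ _))
  simp only [hermiteFun, ← Finset.prod_mul_distrib]
  exact h

theorem PhiC_memLp {d : ℕ} (α : Fin d → ℕ) : MemLp (PhiC α) 2 volume := by
  have hc : Continuous (PhiC α) := Complex.continuous_ofReal.comp (hermiteFun_continuous α)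
  refine (memLp_two_iff_integrable_sq_norm hc.aestronglyMeasurable).2 ?_
  refine (hermiteFun_integrable α α).congr (Eventually.of_forall fun x => ?_)
  simp [PhiC, sq]

theorem PhiC_orthonormal (d : ℕ) :
    Orthonormal ℂ (fun α : Fin d → ℕ => (PhiC_memLp α).toLp (PhiC α)) := by
  classical
  rw [orthonormal_iff_ite]
  intro α β
  rw [L2.inner_def]
  have : ∫ x, inner ℂ ((PhiC_memLp α).toLp (PhiC α) x) ((PhiC_memLp β).toLp (PhiC β) x) =
      ∫ x : Esp d, ((hermiteFun α x * hermiteFun β x : ℝ) : ℂ) := by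
    apply integral_congr_ae
    filter_upwards [(PhiC_memLp α).coeFn_toLp, (PhiC_memLp β).coeFn_toLp] with x h1 h2
    rw [h1, h2]
    simp [PhiC, mul_comm]
  rw [this, integral_complex_ofReal, hermiteFun_integral]
  split_ifs <;> simp

theorem toLp_sum_PhiC {d : ℕ} (S : Finset (Fin d → ℕ)) (g : (Fin d → ℕ) → (Fin d → ℕ))
    (a : (Fin d → ℕ) → ℂ) :
    ∃ h : MemLp (∑ α ∈ S, a α • PhiC (g α)) 2 volume,
      h.toLp _ = ∑ α ∈ S, a α • (PhiC_memLp (g α)).toLp (PhiC (g α)) := by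
  classical
  induction S using Finset.induction_on with
  | empty => exact ⟨by simp, rfl⟩
  | insert b S hb ih =>
    obtain ⟨h, e⟩ := ih
    rw [Finset.sum_insert hb, Finset.sum_insert hb]
    refine ⟨((PhiC_memLp (g b)).const_smul (a b)).add h, ?_⟩
    rw [MemLp.toLp_add ((PhiC_memLp (g b)).const_smul (a b)) h, e, MemLp.toLp_const_smul]

theorem eLpNorm_sum_PhiC {d : ℕ} (S : Finset (Fin d → ℕ)) (g : (Fin d → ℕ) → (Fin d → ℕ))
    (hg : Set.InjOn g S) (a : (Fin d → ℕ) → ℂ) :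
    eLpNorm (∑ α ∈ S, a α • PhiC (g α)) 2 volume =
      ENNReal.ofReal (Real.sqrt (∑ α ∈ S, ‖a α‖ ^ 2)) := by
  classical
  obtain ⟨h, e⟩ := toLp_sum_PhiC S g a
  have hn : ‖h.toLp _‖ ^ 2 = ∑ α ∈ S, ‖a α‖ ^ 2 := by
    have hi : inner ℂ (h.toLp _) (h.toLp _) = ((∑ α ∈ S, ‖a α‖ ^ 2 : ℝ) : ℂ) := by
      rw [e]
      simp only [sum_inner, inner_sum, inner_smul_left, inner_smul_right,
        orthonormal_iff_ite.1 (PhiC_orthonormal d)]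
      push_cast
      refine Finset.sum_congr rfl fun α hα => ?_
      rw [Finset.sum_eq_single α]
      · simp only [if_true, mul_one]
        rw [mul_comm, Complex.conj_mul']
      · intro β hβ hne
        rw [if_neg (fun h => hne (hg hβ hα h))]; simp
      · intro h; exact absurd hα h
    have := inner_self_eq_norm_sq_to_K (𝕜 := ℂ) (h.toLp _)
    rw [hi] at this
    have h3 := congrArg Complex.re this
    rw [Complex.ofReal_re] at h3
    rw [h3]
    norm_cast
  rw [← hn, Real.sqrt_sq (norm_nonneg _), Lp.norm_toLp, ENNReal.ofReal_toReal h.2.ne]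

/-! ### Ladder relations -/

def upd {d : ℕ} (i : Fin d) (α : Fin d → ℕ) (k : ℕ) : Fin d → ℕ := Function.update α i k

theorem hermiteFun_upd {d : ℕ} (i : Fin d) (α : Fin d → ℕ) (k : ℕ) (x : Esp d) :
    hermiteFun (upd i α k) x = hermite1 k (x i) *
      ∏ j ∈ Finset.univ.erase i, hermite1 (α j) (x j) := by
  unfold hermiteFun upd
  rw [← Finset.mul_prod_erase _ _ (Finset.mem_univ i), Function.update_self]
  congr 1
  refine Finset.prod_congr rfl fun j hj => ?_
  rw [Function.update_of_ne (Finset.ne_of_mem_erase hj)]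

theorem hermiteFun_split {d : ℕ} (i : Fin d) (α : Fin d → ℕ) (x : Esp d) :
    hermiteFun α x = hermite1 (α i) (x i) *
      ∏ j ∈ Finset.univ.erase i, hermite1 (α j) (x j) := by
  rw [← hermiteFun_upd]; simp [upd]

theorem PhiC_mul {d : ℕ} (i : Fin d) (α : Fin d → ℕ) (x : Esp d) :
    ((x i : ℝ) : ℂ) * PhiC α x = (Real.sqrt ((α i + 1) / 2) : ℂ) * PhiC (upd i α (α i + 1)) x
      + (Real.sqrt (α i / 2) : ℂ) * PhiC (upd i α (α i - 1)) x := by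
  unfold PhiC
  norm_cast
  rw [hermiteFun_upd, hermiteFun_upd, hermiteFun_split i, ← mul_assoc, hermite1_mul]
  push_cast
  ring

theorem hermiteFun_differentiable {d : ℕ} (α : Fin d → ℕ) : Differentiable ℝ (hermiteFun α) := by
  have h : ∀ j : Fin d, Differentiable ℝ (fun x : Esp d => hermite1 (α j) (x j)) := fun j =>
    (hermite1_differentiable _).comp (by fun_prop)
  unfold hermiteFun
  fun_prop

theorem PhiC_differentiable {d : ℕ} (α : Fin d → ℕ) : Differentiable ℝ (PhiC α) :=
  Complex.ofRealCLM.differentiable.comp (hermiteFun_differentiable α)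

theorem PhiC_pderiv {d : ℕ} (i : Fin d) (α : Fin d → ℕ) (x : Esp d) :
    pderivI i (PhiC α) x = -(Real.sqrt ((α i + 1) / 2) : ℂ) * PhiC (upd i α (α i + 1)) x
      + (Real.sqrt (α i / 2) : ℂ) * PhiC (upd i α (α i - 1)) x := by
  unfold pderivI
  rw [← (PhiC_differentiable α x).lineDeriv_eq_fderiv]
  have h : HasDerivAt (fun t : ℝ => hermite1 (α i) (x i + t) *
      ∏ j ∈ Finset.univ.erase i, hermite1 (α j) (x j))
      ((Real.sqrt (α i / 2) * hermite1 (α i - 1) (x i)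
      - Real.sqrt ((α i + 1) / 2) * hermite1 (α i + 1) (x i)) *
        ∏ j ∈ Finset.univ.erase i, hermite1 (α j) (x j)) 0 := by
    refine HasDerivAt.mul_const ?_ _
    have := hermite1_deriv (α i) (x i + 0)
    have h2 := HasDerivAt.comp_const_add (x i) 0 this
    simpa using h2
  have h3 := h.ofReal_comp
  unfold lineDeriv
  have e : (fun t : ℝ => PhiC α (x + t • EuclideanSpace.single i 1)) =
      fun t : ℝ => ((hermite1 (α i) (x i + t) *
      ∏ j ∈ Finset.univ.erase i, hermite1 (α j) (x j) : ℝ) : ℂ) := by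
    funext t
    unfold PhiC
    rw [hermiteFun_split i]
    congr 2
    · simp
    · refine Finset.prod_congr rfl fun j hj => ?_
      have := Finset.ne_of_mem_erase hj
      simp [this]
  rw [e, h3.deriv]
  unfold PhiC
  rw [hermiteFun_upd, hermiteFun_upd]
  push_cast
  ring

theorem PhiC_mem {d N : ℕ} (α : Fin d → ℕ) (h : ∑ i, α i ≤ N) : PhiC α ∈ hermiteSpan d N :=
  Submodule.subset_span ⟨α, h, rfl⟩

theorem hermiteSpan_rep {d N : ℕ} {f : Esp d → ℂ} (hf : f ∈ hermiteSpan d N) :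
    ∃ (S : Finset (Fin d → ℕ)) (c : (Fin d → ℕ) → ℂ), (∀ α ∈ S, ∑ i, α i ≤ N) ∧
      f = ∑ α ∈ S, c α • PhiC α := by
  have e : {g : Esp d → ℂ | ∃ α : Fin d → ℕ, (∑ i, α i) ≤ N ∧
      g = fun x => ((hermiteFun α x : ℝ) : ℂ)} = PhiC '' {α : Fin d → ℕ | ∑ i, α i ≤ N} := by
    ext g
    constructor
    · rintro ⟨α, h, rfl⟩; exact ⟨α, h, rfl⟩
    · rintro ⟨α, h, rfl⟩; exact ⟨α, h, rfl⟩
  unfold hermiteSpan at hf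
  rw [e, Finsupp.mem_span_image_iff_linearCombination] at hf
  obtain ⟨l, hl, rfl⟩ := hf
  exact ⟨l.support, l, fun α hα => hl hα, rfl⟩

theorem sum_upd {d : ℕ} (i : Fin d) (α : Fin d → ℕ) (k : ℕ) :
    ∑ j, upd i α k j + α i = ∑ j, α j + k := by
  unfold upd
  rw [Finset.sum_update_of_mem (Finset.mem_univ i),
    ← Finset.add_sum_erase Finset.univ α (Finset.mem_univ i), Finset.sdiff_singleton_eq_erase]
  ring

theorem upd_inj {d : ℕ} (i : Fin d) (α β : Fin d → ℕ) (k l : ℕ) (h : upd i α k = upd i β l) :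
    k = l ∧ ∀ j, j ≠ i → α j = β j := by
  unfold upd at h
  refine ⟨by simpa using congrFun h i, fun j hj => ?_⟩
  simpa [hj] using congrFun h j

/-- The bound and stability for one step. -/
theorem ladder_step {d N : ℕ} (i : Fin d) (S : Finset (Fin d → ℕ)) (c : (Fin d → ℕ) → ℂ)
    (hS : ∀ α ∈ S, ∑ i, α i ≤ N) (s : ℂ) (hs : ‖s‖ = 1) (R : Esp d → ℂ)
    (hR : ∀ x, R x = ∑ α ∈ S, c α * (s * (Real.sqrt ((α i + 1) / 2) : ℂ) *
      PhiC (upd i α (α i + 1)) x + (Real.sqrt (α i / 2) : ℂ) * PhiC (upd i α (α i - 1)) x)) :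
    R ∈ hermiteSpan d (N + 1) ∧
      eLpNorm R 2 volume ≤ ENNReal.ofReal (Real.sqrt (2 * (N + 1))) *
        eLpNorm (∑ α ∈ S, c α • PhiC α) 2 volume := by
  classical
  set A : (Fin d → ℕ) → ℂ := fun α => c α * (s * (Real.sqrt ((α i + 1) / 2) : ℂ)) with hA
  set B : (Fin d → ℕ) → ℂ := fun α => c α * (Real.sqrt (α i / 2) : ℂ) with hB
  set S' := S.filter (fun α => α i ≠ 0) with hS'
  have e : R = (∑ α ∈ S, A α • PhiC (upd i α (α i + 1))) +
      ∑ α ∈ S', B α • PhiC (upd i α (α i - 1)) := by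
    have e2 : (∑ α ∈ S', B α • PhiC (upd i α (α i - 1))) =
        ∑ α ∈ S, B α • PhiC (upd i α (α i - 1)) := by
      refine Finset.sum_subset (Finset.filter_subset _ _) fun α hα hn => ?_
      have : α i = 0 := by
        by_contra h0
        exact hn (Finset.mem_filter.2 ⟨hα, h0⟩)
      simp [hB, this]
    rw [e2, ← Finset.sum_add_distrib]
    funext x
    rw [hR, Finset.sum_apply]
    refine Finset.sum_congr rfl fun α _ => ?_
    simp only [Pi.add_apply, Pi.smul_apply, smul_eq_mul, hA, hB]
    ring
  have hle : ∀ α ∈ S, α i ≤ N := fun α hα =>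
    (Finset.single_le_sum (fun j _ => Nat.zero_le (α j)) (Finset.mem_univ i)).trans (hS α hα)
  constructor
  · rw [e]
    refine Submodule.add_mem _ (Submodule.sum_mem _ fun α hα => Submodule.smul_mem _ _ ?_)
      (Submodule.sum_mem _ fun α hα => Submodule.smul_mem _ _ ?_)
    · refine PhiC_mem _ ?_
      have := sum_upd i α (α i + 1)
      have := hS α hα
      omega
    · refine PhiC_mem _ ?_
      have := sum_upd i α (α i - 1)
      have := hS α (Finset.filter_subset _ _ hα)
      omega
  · have n1 := eLpNorm_sum_PhiC S (fun α => upd i α (α i + 1)) (by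
      intro α _ β _ h
      obtain ⟨h1, h2⟩ := upd_inj i α β _ _ h
      funext j
      by_cases hj : j = i
      · subst hj; omega
      · exact h2 j hj) A
    have n2 := eLpNorm_sum_PhiC S' (fun α => upd i α (α i - 1)) (by
      intro α hα β hβ h
      obtain ⟨h1, h2⟩ := upd_inj i α β _ _ h
      have h3 := (Finset.mem_filter.1 hα).2
      have h4 := (Finset.mem_filter.1 hβ).2
      funext j
      by_cases hj : j = i
      · subst hj; omega
      · exact h2 j hj) B
    have n0 := eLpNorm_sum_PhiC S id (fun _ _ _ _ h => h) c
    simp only [id] at n0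
    set T : ℝ := ∑ α ∈ S, ‖c α‖ ^ 2 with hT
    have hT0 : 0 ≤ T := Finset.sum_nonneg fun _ _ => by positivity
    have b1 : ∑ α ∈ S, ‖A α‖ ^ 2 ≤ (N + 1) / 2 * T := by
      rw [hT, Finset.mul_sum]
      refine Finset.sum_le_sum fun α hα => ?_
      have : ((α i : ℕ) : ℝ) ≤ N := by exact_mod_cast hle α hα
      have h0 : (0 : ℝ) ≤ ((α i : ℝ) + 1) / 2 := by positivity
      simp only [hA, norm_mul, hs, one_mul, mul_pow, Complex.norm_real, Real.norm_eq_abs, sq_abs,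
        Real.sq_sqrt h0]
      rw [mul_comm]
      gcongr
    have b2 : ∑ α ∈ S', ‖B α‖ ^ 2 ≤ (N + 1) / 2 * T := by
      rw [hT, Finset.mul_sum]
      refine (Finset.sum_le_sum_of_subset_of_nonneg (Finset.filter_subset _ _)
        (fun _ _ _ => by positivity)).trans (Finset.sum_le_sum fun α hα => ?_)
      have : ((α i : ℕ) : ℝ) ≤ N := by exact_mod_cast hle α hα
      have h0 : (0 : ℝ) ≤ (α i : ℝ) / 2 := by positivity
      simp only [hB, norm_mul, mul_pow, Complex.norm_real, Real.norm_eq_abs, sq_abs,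
        Real.sq_sqrt h0]
      rw [mul_comm]
      gcongr
      linarith
    obtain ⟨m1, -⟩ := toLp_sum_PhiC S (fun α => upd i α (α i + 1)) A
    obtain ⟨m2, -⟩ := toLp_sum_PhiC S' (fun α => upd i α (α i - 1)) B
    rw [e]
    refine (eLpNorm_add_le m1.1 m2.1 (by norm_num)).trans ?_
    rw [n1, n2, n0, ← ENNReal.ofReal_add (Real.sqrt_nonneg _) (Real.sqrt_nonneg _),
      ← ENNReal.ofReal_mul (Real.sqrt_nonneg _)]
    refine ENNReal.ofReal_le_ofReal ?_
    refine (add_le_add (Real.sqrt_le_sqrt b1) (Real.sqrt_le_sqrt b2)).trans (le_of_eq ?_)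
    rw [← Real.sqrt_mul (by positivity), show (2 * (N + 1) * T : ℝ) = 2 ^ 2 * ((N + 1) / 2 * T) by
      ring, Real.sqrt_mul (by positivity : (0 : ℝ) ≤ 2 ^ 2), Real.sqrt_sq (by norm_num)]
    ring

/-! ### Composition of bounded operators along the filtration -/

def KK (N m : ℕ) : ℝ := Real.sqrt (2 ^ m * ((N + m).factorial / N.factorial))

theorem KK_comp (N m n : ℕ) : KK N m * KK (N + m) n = KK N (m + n) := by
  unfold KK
  rw [← Real.sqrt_mul (by positivity)]
  congr 1
  have : ((N + m).factorial : ℝ) ≠ 0 := by exact_mod_cast (N + m).factorial_ne_zero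
  rw [← add_assoc]
  field_simp
  ring

theorem KK_one (N : ℕ) : KK N 1 = Real.sqrt (2 * (N + 1)) := by
  unfold KK
  have : (N.factorial : ℝ) ≠ 0 := by exact_mod_cast N.factorial_ne_zero
  rw [Nat.factorial_succ]
  push_cast
  congr 1
  field_simp

def Good {d : ℕ} (m : ℕ) (T : (Esp d → ℂ) → (Esp d → ℂ)) : Prop :=
  ∀ N f, f ∈ hermiteSpan d N → T f ∈ hermiteSpan d (N + m) ∧
    eLpNorm (T f) 2 volume ≤ ENNReal.ofReal (KK N m) * eLpNorm f 2 volume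

theorem Good.id' {d : ℕ} : Good (d := d) 0 (fun f => f) := by
  intro N f hf
  refine ⟨hf, ?_⟩
  have : (N.factorial : ℝ) ≠ 0 := by exact_mod_cast N.factorial_ne_zero
  simp [KK, this]

theorem Good.comp {d m n : ℕ} {T U : (Esp d → ℂ) → (Esp d → ℂ)} (hT : Good m T) (hU : Good n U) :
    Good (m + n) (fun f => T (U f)) := by
  intro N f hf
  obtain ⟨a, b⟩ := hU N f hf
  obtain ⟨a', b'⟩ := hT _ _ a
  refine ⟨by rw [add_comm m n, ← add_assoc]; exact a', b'.trans ?_⟩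
  rw [add_comm m n, ← KK_comp, ENNReal.ofReal_mul (show 0 ≤ KK N n from Real.sqrt_nonneg _),
    mul_comm (ENNReal.ofReal (KK N n)), mul_assoc]
  gcongr

theorem Good.iter {d m : ℕ} {T : (Esp d → ℂ) → (Esp d → ℂ)} (hT : Good m T) (k : ℕ) :
    Good (k * m) (fun f => T^[k] f) := by
  induction k with
  | zero => simpa using Good.id'
  | succ k ih =>
    have := hT.comp ih
    simp only [Function.iterate_succ_apply']
    rwa [add_mul, one_mul, add_comm]

theorem Good.foldr {d n : ℕ} (T : Fin n → (Esp d → ℂ) → (Esp d → ℂ)) (m : Fin n → ℕ)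
    (hT : ∀ i, Good (m i) (T i)) : Good (∑ i, m i) (fun f => Fin.foldr n T f) := by
  induction n with
  | zero => simpa using Good.id'
  | succ n ih =>
    simp only [Fin.foldr_succ, Fin.sum_univ_succ]
    exact (hT 0).comp (ih (fun i => T i.succ) (fun i => m i.succ) fun i => hT _)

theorem good_mul {d : ℕ} (i : Fin d) :
    Good 1 (fun (f : Esp d → ℂ) (x : Esp d) => ((x i : ℝ) : ℂ) * f x) := by
  intro N f hf
  obtain ⟨S, c, hS, rfl⟩ := hermiteSpan_rep hf
  rw [KK_one]
  refine ladder_step i S c hS 1 (by simp) _ fun x => ?_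
  simp only
  rw [Finset.sum_apply, Finset.mul_sum]
  refine Finset.sum_congr rfl fun α _ => ?_
  rw [Pi.smul_apply, smul_eq_mul, one_mul, ← PhiC_mul]
  ring

theorem good_pderiv {d : ℕ} (i : Fin d) : Good (d := d) 1 (pderivI i) := by
  intro N f hf
  obtain ⟨S, c, hS, rfl⟩ := hermiteSpan_rep hf
  rw [KK_one]
  refine ladder_step i S c hS (-1) (by simp) _ fun x => ?_
  have : pderivI i (∑ α ∈ S, c α • PhiC α) x = ∑ α ∈ S, c α * pderivI i (PhiC α) x := by
    unfold pderivI
    rw [fderiv_sum fun α _ => ((PhiC_differentiable α).const_smul (c α)) x]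
    simp only [_root_.sum_apply]
    refine Finset.sum_congr rfl fun α _ => ?_
    rw [fderiv_const_smul (PhiC_differentiable α x)]
    simp
  rw [this]
  refine Finset.sum_congr rfl fun α _ => ?_
  rw [PhiC_pderiv]
  ring

theorem good_mderiv {d : ℕ} (β : Fin d → ℕ) : Good (∑ i, β i) (mderiv β) := by
  refine Good.foldr (fun i g => (pderivI i)^[β i] g) β fun i => ?_
  simpa using (good_pderiv i).iter (β i)

theorem good_monomial {d : ℕ} (α : Fin d → ℕ) :
    Good (∑ i, α i) (fun (f : Esp d → ℂ) (x : Esp d) => ((∏ i, x i ^ α i : ℝ) : ℂ) * f x) := by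
  classical
  have key : ∀ s : Finset (Fin d), Good (∑ i ∈ s, α i)
      (fun (f : Esp d → ℂ) (x : Esp d) => ((∏ i ∈ s, x i ^ α i : ℝ) : ℂ) * f x) := by
    intro s
    induction s using Finset.induction_on with
    | empty => simpa using Good.id'
    | insert j s hj ih =>
      have h1 := (good_mul (d := d) j).iter (α j)
      have e : ∀ (k : ℕ) (f : Esp d → ℂ),
          (fun (f : Esp d → ℂ) (x : Esp d) => ((x j : ℝ) : ℂ) * f x)^[k] f =
          fun x => ((x j : ℝ) : ℂ) ^ k * f x := by
        intro k f
        induction k with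
        | zero => simp
        | succ k ihk =>
          rw [Function.iterate_succ_apply', ihk]
          funext x
          simp only
          ring
      simp only [e, mul_one] at h1
      have := h1.comp ih
      rw [Finset.sum_insert hj]
      refine (congrArg (Good _) ?_).mp this
      funext f x
      rw [Finset.prod_insert hj]
      push_cast
      ring
  exact key Finset.univ

/-- Bernstein estimates for finite combinations of Hermite functions
(Lemma `lem1`, from Beauchard–Jaming–Pravda-Starov). -/
theorem stmt_8 (d : ℕ) (hd : 1 ≤ d) (N : ℕ) (f : Esp d → ℂ) (hf : f ∈ hermiteSpan d N)
    (α β : Fin d → ℕ) :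
    eLpNorm (fun x => ((∏ i, x i ^ α i : ℝ) : ℂ) * mderiv β f x) 2 volume ≤
      ENNReal.ofReal
        ((2 : ℝ) ^ ((((∑ i, α i) + ∑ i, β i : ℕ) : ℝ) / 2) *
          Real.sqrt (((N + (∑ i, α i) + ∑ i, β i).factorial : ℝ) / (N.factorial : ℝ))) *
      eLpNorm f 2 volume := by
  have h := (good_monomial α).comp (good_mderiv β) N f hf
  refine h.2.trans (le_of_eq ?_)
  congr 2
  unfold KK
  rw [Real.sqrt_mul (by positivity), Real.sqrt_eq_rpow (2 ^ _), ← Real.rpow_natCast_mul (by norm_num),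
    ← add_assoc]
  congr 2
  ring

end
end
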